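/- arXiv:1407.8170 — 12 statements merged into one kernel-verified Lean document; each statement's English description precedes it below -/
import Mathlib

section
/- For every uniform instance of the asymmetric binary matrix partition problem and every full cover C of the set A^+ of one-columns, the maximum partition value over all partition schemes that contain C is at least 9/10 times the maximum partition value over all partition schemes. (Equivalently, the greedy algorithm, which picks an arbitrary full cover and then completes it optimally, is a 9/10-approximation.) -/
open Finset

structure PartitionScheme (n m : ℕ) where
  bundle : Fin n → Fin m → Finset (Fin m)
  mem_bundle : ∀ i j, j ∈ bundle i j
  consistent : ∀ i j j', j' ∈ bundle i j → bundle i j' = bundle i j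

noncomputable def smoothValue {n m : ℕ} (A : Fin n → Fin m → ℝ) (p : Fin m → ℝ)
    (B : PartitionScheme n m) (i : Fin n) (j : Fin m) : ℝ :=
  (∑ ℓ ∈ B.bundle i j, p ℓ * A i ℓ) / ∑ ℓ ∈ B.bundle i j, p ℓ

noncomputable def partitionValue {n m : ℕ} (A : Fin n → Fin m → ℝ) (p : Fin m → ℝ)
    (B : PartitionScheme n m) : ℝ :=
  ∑ j, p j * ⨆ i, smoothValue A p B i j

/-- A bundle `b` is mixed in row `i` if it contains both a 1-entry and a 0-entry of row `i`. -/
def MixedBundle {n m : ℕ} (A : Fin n → Fin m → ℝ) (i : Fin n) (b : Finset (Fin m)) : Prop :=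
  (∃ j ∈ b, A i j = 1) ∧ (∃ j ∈ b, A i j = 0)

/-- `B` fully covers the set of one-columns. -/
def FullyCovers {n m : ℕ} (A : Fin n → Fin m → ℝ) (B : PartitionScheme n m) : Prop :=
  ∀ j : Fin m, (∃ i, A i j = 1) → ∃ i, A i j = 1 ∧ B.bundle i j = {j}

open scoped Classical in
noncomputable def mixedOneAppearances {n m : ℕ} (A : Fin n → Fin m → ℝ)
    (B : PartitionScheme n m) : ℕ :=
  ∑ i, ∑ b ∈ (Finset.univ.image (B.bundle i)).filter (MixedBundle A i),
    (b.filter (fun j => A i j = 1)).card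

/-- The total value `x * k / (x + k)` that `k` zero entries obtain from a bundle
in which they are joined by `x` one entries. -/
noncomputable def bundleGain (x k : ℝ) : ℝ := x * k / (x + k)

lemma bundleGain_nonneg {x k : ℝ} (hx : 0 ≤ x) (hk : 0 ≤ k) : 0 ≤ bundleGain x k := by
  unfold bundleGain; positivity

lemma bundleGain_zero_left (k : ℝ) : bundleGain 0 k = 0 := by simp [bundleGain]

lemma bundleGain_le_quadratic {x k : ℝ} (hx : 0 ≤ x) (hk : 0 ≤ k) (t : ℝ) :
    bundleGain x k ≤ t ^ 2 * k + (1 - t) ^ 2 * x := by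
  unfold bundleGain
  rcases (add_nonneg hx hk).eq_or_lt with h | h
  · rw [← h]; simp only [div_zero]; positivity
  · rw [div_le_iff₀ h]
    nlinarith [sq_nonneg (t * k - (1 - t) * x)]

lemma exists_bundleGain_eq_quadratic {x k : ℝ} (hx : 0 ≤ x) (hk : 0 ≤ k) :
    ∃ t : ℝ, 0 ≤ t ∧ t ≤ 1 ∧ bundleGain x k = t ^ 2 * k + (1 - t) ^ 2 * x := by
  rcases (add_nonneg hx hk).eq_or_lt with h | h
  · obtain rfl : x = 0 := by linarith
    obtain rfl : k = 0 := by linarith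
    exact ⟨0, le_rfl, zero_le_one, by simp [bundleGain]⟩
  · refine ⟨x / (x + k), by positivity, (div_le_one h).2 (by linarith), ?_⟩
    unfold bundleGain
    field_simp
    ring

lemma bundleGain_add_le {x k y l : ℝ} (hx : 0 ≤ x) (hk : 0 ≤ k) (hy : 0 ≤ y) (hl : 0 ≤ l) :
    bundleGain x k + bundleGain y l ≤ bundleGain (x + y) (k + l) := by
  obtain ⟨t, -, -, ht⟩ := exists_bundleGain_eq_quadratic (add_nonneg hx hy) (add_nonneg hk hl)
  rw [ht]
  linarith [bundleGain_le_quadratic hx hk t, bundleGain_le_quadratic hy hl t]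

lemma nat_mul_bundleGain_one_le (c l : ℕ) : c * bundleGain 1 l ≤ bundleGain c (c * l) := by
  rcases Nat.eq_zero_or_pos c with rfl | hc
  · simp [bundleGain]
  · have : (0 : ℝ) < c := by exact_mod_cast hc
    unfold bundleGain
    apply le_of_eq
    field_simp

lemma bundleGain_le_right {x k : ℝ} (hx : 0 ≤ x) (hk : 0 ≤ k) : bundleGain x k ≤ k := by
  simpa using bundleGain_le_quadratic hx hk 1

lemma bundleGain_le_left {x k : ℝ} (hx : 0 ≤ x) (hk : 0 ≤ k) : bundleGain x k ≤ x := by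
  simpa using bundleGain_le_quadratic hx hk 0

lemma bundleGain_add_left_le {x c k : ℝ} (hx : 0 ≤ x) (hc : 0 ≤ c) (hk : 0 ≤ k) :
    bundleGain (x + c) k ≤ bundleGain x k + c := by
  obtain ⟨t, h0, h1, ht⟩ := exists_bundleGain_eq_quadratic hx hk
  have := bundleGain_le_quadratic (add_nonneg hx hc) hk t
  rw [ht]
  nlinarith [mul_nonneg hc h0, mul_nonneg (mul_nonneg hc h0) (sub_nonneg.2 h1)]

lemma bundleGain_succ_sub {x : ℝ} (hx : 0 < x) {l : ℝ} (hl : 0 ≤ l) :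
    bundleGain x (l + 1) - bundleGain x l = x ^ 2 / ((x + l) * (x + l + 1)) := by
  unfold bundleGain
  have h1 : x + l ≠ 0 := by positivity
  have h2 : x + (l + 1) ≠ 0 := by positivity
  have h3 : x + l + 1 ≠ 0 := by positivity
  field_simp
  ring

lemma bundleGain_succ_sub_nonneg {x l : ℝ} (hx : 0 ≤ x) (hl : 0 ≤ l) :
    0 ≤ bundleGain x (l + 1) - bundleGain x l := by
  rcases hx.eq_or_lt with rfl | hx
  · simp [bundleGain_zero_left]
  · rw [bundleGain_succ_sub hx hl]; positivity

lemma bundleGain_succ_sub_le_one {x l : ℝ} (hx : 0 ≤ x) (hl : 0 ≤ l) :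
    bundleGain x (l + 1) - bundleGain x l ≤ 1 := by
  rcases hx.eq_or_lt with rfl | hx
  · simp [bundleGain_zero_left]
  · rw [bundleGain_succ_sub hx hl, div_le_one (by positivity)]
    nlinarith [mul_nonneg hx.le hl]

lemma bundleGain_concave {x l : ℝ} (hx : 0 ≤ x) (hl : 0 ≤ l) :
    bundleGain x (l + 1 + 1) - bundleGain x (l + 1) ≤ bundleGain x (l + 1) - bundleGain x l := by
  rcases hx.eq_or_lt with rfl | hx
  · simp [bundleGain_zero_left]
  · rw [bundleGain_succ_sub hx hl, bundleGain_succ_sub hx (by positivity)]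
    gcongr <;> linarith

/-- A concave sequence penalised by a supporting slope at `l₀` is maximised at `l₀`. -/
lemma penalized_le_of_concave {g : ℕ → ℝ} (hg : ∀ l, g (l + 2) - g (l + 1) ≤ g (l + 1) - g l)
    {a : ℝ} {l₀ : ℕ} (hup : g (l₀ + 1) - g l₀ ≤ a)
    (hdown : ∀ l, l + 1 = l₀ → a ≤ g (l + 1) - g l) (l : ℕ) :
    g l - a * l ≤ g l₀ - a * l₀ := by
  have hanti : Antitone fun l => g (l + 1) - g l := antitone_nat_of_succ_le hg
  rcases le_total l₀ l with h | h
  · induction l, h using Nat.le_induction with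
    | base => exact le_rfl
    | succ l hl ih =>
      have := hanti hl
      push_cast
      simp only at this
      linarith
  · induction h using Nat.decreasingInduction with
    | of_succ l hl ih =>
      obtain ⟨q, rfl⟩ : ∃ q, l₀ = q + 1 := ⟨l₀ - 1, by omega⟩
      have h1 := hdown q rfl
      have h2 := hanti (show l ≤ q by omega)
      push_cast at ih ⊢
      simp only at h2
      linarith
    | self => exact le_rfl

/-- Linear interpolation of the gain between consecutive integers. -/
lemma exists_interpolation_bound {x a h : ℝ} (hx : 0 < x)
    (hh : ∀ l : ℕ, bundleGain x l - a * l ≤ h) {u : ℝ} (hu : 0 ≤ u) :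
    ∃ p : ℕ, ∃ b : ℝ, 0 ≤ b ∧ b ≤ 1 ∧ u = p + b ∧
      x * u - x ^ 2 * (b * (1 - b)) / ((x + p) * (x + p + 1)) ≤ (x + u) * (h + a * u) := by
  obtain ⟨p, b, hb0, hb1, rfl⟩ : ∃ p : ℕ, ∃ b : ℝ, 0 ≤ b ∧ b ≤ 1 ∧ u = p + b :=
    ⟨⌊u⌋₊, u - ⌊u⌋₊, by linarith [Nat.floor_le hu], by linarith [Nat.lt_floor_add_one u], by ring⟩
  refine ⟨p, b, hb0, hb1, rfl, ?_⟩
  have h1 := hh p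
  have h2 := hh (p + 1)
  push_cast at h2
  have hp : (0 : ℝ) ≤ p := Nat.cast_nonneg p
  have key : (1 - b) * bundleGain x p + b * bundleGain x (p + 1) ≤ h + a * (p + b) := by
    nlinarith [mul_le_mul_of_nonneg_left h1 (sub_nonneg.2 hb1), mul_le_mul_of_nonneg_left h2 hb0]
  refine le_trans (le_of_eq ?_) (mul_le_mul_of_nonneg_left key (by positivity))
  unfold bundleGain
  have h1 : x + p ≠ 0 := by positivity
  have h2 : x + (p + 1) ≠ 0 := by positivity
  have h3 : x + p + 1 ≠ 0 := by positivity
  field_simp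
  ring

lemma unit_interpolation_bound {a h : ℝ} (hh : ∀ l : ℕ, bundleGain 1 l - a * l ≤ h)
    {u : ℝ} (hu : 0 ≤ u) : 0.8 * u - 0.045 ≤ (1 + u) * (h + a * u) := by
  obtain ⟨p, b, hb0, hb1, rfl, H⟩ := exists_interpolation_bound one_pos hh hu
  refine le_trans ?_ H
  suffices (1 : ℝ) ^ 2 * (b * (1 - b)) / ((1 + p) * (1 + p + 1)) ≤ 0.045 + 0.2 * (p + b) by
    linarith
  rcases Nat.eq_zero_or_pos p with rfl | hp
  · rw [div_le_iff₀ (by positivity)]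
    push_cast
    nlinarith [sq_nonneg (b - 0.3)]
  · have hp : (1 : ℝ) ≤ p := by exact_mod_cast hp
    rw [div_le_iff₀ (by positivity)]
    have : (6 : ℝ) ≤ (1 + p) * (1 + p + 1) := by nlinarith
    nlinarith [sq_nonneg (b - 0.5), mul_le_mul this (show (0.2 : ℝ) ≤ 0.045 + 0.2 * (p + b) by linarith)
      (by norm_num) (by positivity)]

lemma interpolation_bound {x : ℕ} {a h : ℝ} (hh : ∀ l : ℕ, bundleGain x l - a * l ≤ h)
    {κ : ℝ} (hκ : 0 ≤ κ) (hx : x ≠ 1 ∨ 1 ≤ κ) :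
    0.9 * (x * κ) - 0.055 ≤ (1 + κ) * (h + a * (x * κ)) := by
  rcases Nat.eq_zero_or_pos x with rfl | hx0
  · have := hh 0
    simp only [Nat.cast_zero, bundleGain_zero_left, mul_zero, sub_zero] at this
    simp only [Nat.cast_zero, zero_mul, mul_zero, add_zero]
    nlinarith [mul_nonneg this hκ]
  have hx1 : (1 : ℝ) ≤ x := by exact_mod_cast hx0
  obtain ⟨p, b, hb0, hb1, hu, H⟩ := exists_interpolation_bound (by linarith) hh
    (show 0 ≤ x * κ by positivity)
  have hp : (0 : ℝ) ≤ p := Nat.cast_nonneg p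
  have hE : (x : ℝ) ^ 2 * (b * (1 - b)) / ((x + p) * (x + p + 1)) ≤
      x * (0.055 + 0.1 * (x * κ)) := by
    rw [div_le_iff₀ (by positivity), hu]
    have hbb : 0 ≤ b * (1 - b) := mul_nonneg hb0 (by linarith)
    suffices x * (b * (1 - b)) ≤ (0.055 + 0.1 * (p + b)) * ((x + p) * (x + p + 1)) by
      nlinarith [mul_le_mul_of_nonneg_left this (show (0 : ℝ) ≤ x by positivity)]
    suffices b * (1 - b) ≤ (0.055 + 0.1 * (p + b)) * (x + p + 1) by
      calc x * (b * (1 - b)) ≤ (x + p) * (b * (1 - b)) := by gcongr; linarith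
        _ ≤ (x + p) * ((0.055 + 0.1 * (p + b)) * (x + p + 1)) := by gcongr
        _ = _ := by ring
    rcases Nat.eq_zero_or_pos p with rfl | hp1
    · simp only [Nat.cast_zero, zero_add, add_zero] at hu ⊢
      have hx2 : (2 : ℝ) ≤ x ∨ b = 1 := by
        by_cases h : x = 1
        · right
          subst h
          have : 1 ≤ κ := by simpa using hx
          simp only [Nat.cast_one, one_mul] at hu
          linarith
        · left
          exact_mod_cast (show 2 ≤ x by omega)
      rcases hx2 with hx2 | rfl
      · calc b * (1 - b) ≤ (0.055 + 0.1 * b) * 3 := by nlinarith [sq_nonneg (b - 0.35)]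
          _ ≤ _ := by gcongr; linarith
      · nlinarith
    · have hp1 : (1 : ℝ) ≤ p := by exact_mod_cast hp1
      nlinarith [sq_nonneg (b - 0.5), mul_le_mul (show (0.1 : ℝ) ≤ 0.055 + 0.1 * (p + b) by linarith)
        (show (3 : ℝ) ≤ x + p + 1 by linarith) (by norm_num) (by positivity)]
  have hx0 : (0 : ℝ) < x := by linarith
  refine le_of_mul_le_mul_left ?_ hx0
  nlinarith

/-- Detaching `c` units from a bundle of `x + c` ones costs at most `c / 10` beyond the
factor `9 / 10`. -/
lemma detach_units_bound {x c k : ℕ} {a h₁ h : ℝ}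
    (hh₁ : ∀ l : ℕ, bundleGain 1 l - a * l ≤ h₁) (hh : ∀ l : ℕ, bundleGain x l - a * l ≤ h) :
    0.9 * bundleGain (x + c) k ≤ (0.1 + h₁) * c + a * k + h := by
  have hk : (0 : ℝ) ≤ k := Nat.cast_nonneg k
  rcases Nat.eq_zero_or_pos c with rfl | hc
  · have := hh k
    have := bundleGain_nonneg (Nat.cast_nonneg (α := ℝ) x) hk
    simp only [Nat.cast_zero, add_zero, mul_zero]
    linarith
  have hc1 : (1 : ℝ) ≤ c := by exact_mod_cast hc
  have hx0 : (0 : ℝ) ≤ x := Nat.cast_nonneg x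
  obtain ⟨κ, hκ⟩ : ∃ κ : ℝ, κ = k / (x + c) := ⟨_, rfl⟩
  have hκ0 : 0 ≤ κ := by rw [hκ]; positivity
  have hkκ : (k : ℝ) = (x + c) * κ := by rw [hκ]; field_simp
  have hgain : bundleGain (x + c) k = (x + c) * κ / (1 + κ) := by
    unfold bundleGain
    rw [hkκ]
    field_simp
  suffices 0.9 * ((x + c) * κ) ≤ (1 + κ) * ((0.1 + h₁) * c + a * k + h) by
    rw [hgain, ← mul_div_assoc, div_le_iff₀ (by positivity)]
    linarith
  have hU := unit_interpolation_bound hh₁ hκ0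
  by_cases hx : x ≠ 1 ∨ 1 ≤ κ
  · have hX := interpolation_bound hh hκ0 hx
    have := mul_le_mul_of_nonneg_left hU (show (0 : ℝ) ≤ c by linarith)
    rw [hkκ]
    nlinarith
  · push Not at hx
    obtain ⟨rfl, hκ1⟩ := hx
    simp only [Nat.cast_one] at *
    have a0 := hh 0
    have a1 := hh 1
    have b0 := hh₁ 0
    have b1 := hh₁ 1
    norm_num [bundleGain] at a0 a1 b0 b1
    rcases eq_or_ne c 1 with rfl | hc2
    · norm_num at hkκ
      have hk1 : k < 2 := by
        have : (k : ℝ) < 2 := by linarith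
        exact_mod_cast this
      interval_cases k
      · obtain rfl : κ = 0 := by norm_num at hkκ; linarith
        norm_num
        linarith
      · obtain rfl : κ = 1 / 2 := by norm_num at hkκ; linarith
        norm_num
        linarith
    · have hc2 : (2 : ℝ) ≤ c := by exact_mod_cast (show 2 ≤ c by omega)
      have e1 : κ / 2 ≤ h₁ + a * κ := by
        nlinarith [mul_nonneg (sub_nonneg.2 hκ1.le) b0, mul_nonneg hκ0 (sub_nonneg.2 b1)]
      have e2 : κ / 2 ≤ h + a * κ := by
        nlinarith [mul_nonneg (sub_nonneg.2 hκ1.le) a0, mul_nonneg hκ0 (sub_nonneg.2 a1)]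
      have e3 : (1 + c) * (κ / 2) + 0.1 * c ≤ (0.1 + h₁) * c + a * k + h := by
        rw [hkκ]
        nlinarith [mul_le_mul_of_nonneg_left e1 (show (0 : ℝ) ≤ c by linarith)]
      refine le_trans ?_ (mul_le_mul_of_nonneg_left e3 (by positivity))
      nlinarith [mul_nonneg (sub_nonneg.2 hc2) (sq_nonneg (κ - 0.3)), sq_nonneg (κ - 1 / 3)]

/-- Attaching `c` units to a bundle is at least as good as serving them separately. -/
lemma attach_units_bound {x c k : ℕ} {a h₁ h : ℝ}
    (hh₁ : IsLUB (Set.range fun l : ℕ => bundleGain 1 l - a * l) h₁)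
    (hh : ∀ l : ℕ, bundleGain (x + c) l - a * l ≤ h) :
    bundleGain x k + h₁ * c ≤ a * k + h := by
  rcases Nat.eq_zero_or_pos c with rfl | hc
  · have := hh k
    simp only [Nat.cast_zero, add_zero, mul_zero] at *
    linarith
  have hc0 : (0 : ℝ) < c := by exact_mod_cast hc
  suffices h₁ ≤ (a * k + h - bundleGain x k) / c by
    rw [le_div_iff₀ hc0] at this
    linarith
  refine hh₁.2 ?_
  rintro _ ⟨l, rfl⟩
  dsimp only
  rw [le_div_iff₀ hc0]
  have e1 := hh (k + c * l)
  have e2 := nat_mul_bundleGain_one_le c l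
  have e3 := bundleGain_add_le (x := x) (k := k) (y := c) (l := c * l) (by positivity)
    (by positivity) (by positivity) (by positivity)
  push_cast at e1
  nlinarith

/-- The dual price `q` of a one entry, for a given marginal price `a` of a zero entry. -/
lemma exists_price {a : ℝ} (ha0 : 0 ≤ a) (ha1 : a ≤ 1) :
    ∃ q : ℝ, q + a ≤ 0.9 ∧ ∀ (x c x' c' k : ℕ) (h : ℝ), x + c = x' + c' →
      (∀ l : ℕ, bundleGain x l - a * l ≤ h) →
      0.9 * bundleGain x' k + q * c' ≤ (0.1 + q) * c + a * k + h := by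
  obtain ⟨h₁, hh₁⟩ : ∃ h₁, IsLUB (Set.range fun l : ℕ => bundleGain 1 l - a * l) h₁ := by
    refine Real.exists_isLUB (Set.range_nonempty _) ⟨1, ?_⟩
    rintro _ ⟨l, rfl⟩
    have := bundleGain_le_left zero_le_one (Nat.cast_nonneg (α := ℝ) l)
    have : 0 ≤ a * l := by positivity
    dsimp only
    linarith
  have hub : ∀ l : ℕ, bundleGain 1 l - a * l ≤ h₁ := fun l => hh₁.1 ⟨l, rfl⟩
  have hh₁0 : 0 ≤ h₁ := by simpa [bundleGain] using hub 0
  rcases le_or_gt (h₁ + a) 0.9 with hle | hgt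
  · refine ⟨h₁, hle, fun x c x' c' k h hxc hh => ?_⟩
    rcases le_total c' c with hcc | hcc
    · obtain ⟨d, rfl⟩ := Nat.exists_eq_add_of_le hcc
      obtain rfl : x' = x + d := by omega
      have := detach_units_bound (c := d) (k := k) hub hh
      push_cast
      nlinarith [Nat.cast_nonneg (α := ℝ) c']
    · obtain ⟨d, rfl⟩ := Nat.exists_eq_add_of_le hcc
      obtain rfl : x = x' + d := by omega
      push_cast at hh
      have e1 := attach_units_bound (k := k) hh₁ hh
      have e2 := bundleGain_nonneg (Nat.cast_nonneg (α := ℝ) x') (Nat.cast_nonneg (α := ℝ) k)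
      push_cast
      nlinarith [Nat.cast_nonneg (α := ℝ) c]
  · refine ⟨0.9 - a, by linarith, fun x c x' c' k h hxc hh => ?_⟩
    have hx'0 := Nat.cast_nonneg (α := ℝ) x'
    have hk0 := Nat.cast_nonneg (α := ℝ) k
    have hc0 := Nat.cast_nonneg (α := ℝ) c
    have hc'0 := Nat.cast_nonneg (α := ℝ) c'
    have e0 := bundleGain_nonneg hx'0 hk0
    rcases le_or_gt 0.9 a with ha | ha
    · have h0 : 0 ≤ h := by simpa [bundleGain] using hh 0
      have e1 := bundleGain_le_right hx'0 hk0
      nlinarith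
    have ha' : a ≤ 0.1 := by
      by_contra! hlt
      refine absurd (hh₁.2 (?_ : 0.9 - a ∈ upperBounds _)) (by linarith)
      rintro _ ⟨l, rfl⟩
      dsimp only
      have e1 := bundleGain_le_left zero_le_one (Nat.cast_nonneg (α := ℝ) l)
      match l with
      | 0 => norm_num [bundleGain]; linarith
      | 1 => norm_num [bundleGain]
      | l + 2 =>
        push_cast at e1 ⊢
        nlinarith [Nat.cast_nonneg (α := ℝ) l]
    rcases le_total c' c with hcc | hcc
    · obtain ⟨d, rfl⟩ := Nat.exists_eq_add_of_le hcc
      obtain rfl : x' = x + d := by omega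
      have e1 := bundleGain_add_left_le (Nat.cast_nonneg (α := ℝ) x) (Nat.cast_nonneg (α := ℝ) d) hk0
      have e2 := hh k
      have e3 := bundleGain_nonneg (Nat.cast_nonneg (α := ℝ) x) hk0
      push_cast at e0 e1 ⊢
      nlinarith [Nat.cast_nonneg (α := ℝ) d]
    · obtain ⟨d, rfl⟩ := Nat.exists_eq_add_of_le hcc
      obtain rfl : x = x' + d := by omega
      push_cast at hh
      have e1 := attach_units_bound (k := k) hh₁ hh
      push_cast
      nlinarith [Nat.cast_nonneg (α := ℝ) d]

lemma exists_optimal_assignment {I J : Type*} [Fintype I] [DecidableEq I] [Nonempty I]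
    [Fintype J] [DecidableEq J] (Z : Finset J) (x : I → ℕ) :
    ∃ ρ : J → I, ∃ a : ℝ, 0 ≤ a ∧ a ≤ 1 ∧ ∀ (i : I) (l : ℕ),
      bundleGain (x i) l - a * l ≤
        bundleGain (x i) (#{j ∈ Z | ρ j = i}) - a * (#{j ∈ Z | ρ j = i}) := by
  obtain ⟨ρ, hρ⟩ := Finite.exists_max fun ρ : J → I =>
    ∑ i, bundleGain (x i) (#{j ∈ Z | ρ j = i})
  obtain ⟨i₀, hi₀⟩ := Finite.exists_max fun i : I =>
    bundleGain (x i) ((#{j ∈ Z | ρ j = i} : ℕ) + 1) - bundleGain (x i) (#{j ∈ Z | ρ j = i})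
  have hconc : ∀ (i : I) (l : ℕ), bundleGain (x i) ((l + 2 : ℕ) : ℝ) -
      bundleGain (x i) ((l + 1 : ℕ) : ℝ) ≤
      bundleGain (x i) ((l + 1 : ℕ) : ℝ) - bundleGain (x i) (l : ℝ) := fun i l => by
    have := bundleGain_concave (Nat.cast_nonneg (α := ℝ) (x i)) (Nat.cast_nonneg (α := ℝ) l)
    push_cast
    rwa [show (l : ℝ) + 2 = l + 1 + 1 by ring]
  refine ⟨ρ, _, bundleGain_succ_sub_nonneg (Nat.cast_nonneg (x i₀))
    (Nat.cast_nonneg (#{j ∈ Z | ρ j = i₀})), bundleGain_succ_sub_le_one (Nat.cast_nonneg _)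
    (Nat.cast_nonneg _), fun i l => ?_⟩
  refine penalized_le_of_concave (g := fun l : ℕ => bundleGain (x i) l) (hconc i) ?_ ?_ l
  · simpa using hi₀ i
  intro q hq
  rcases eq_or_ne i i₀ with rfl | hne
  · have := hconc i q
    rw [← hq]
    push_cast at this ⊢
    rwa [show (q : ℝ) + 1 + 1 = q + 2 by ring]
  obtain ⟨j, hj⟩ : ({j ∈ Z | ρ j = i}).Nonempty := by
    rw [← Finset.card_pos]; omega
  obtain ⟨hjZ, hji⟩ := Finset.mem_filter.1 hj
  have hmax := hρ (Function.update ρ j i₀)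
  have hcard : ∀ t, t ≠ i → t ≠ i₀ →
      ({j' ∈ Z | Function.update ρ j i₀ j' = t}) = {j ∈ Z | ρ j = t} := fun t h1 h2 => by
    ext j'
    by_cases h : j' = j
    · subst h; simp [hji, h1.symm, h2.symm]
    · simp [h]
  have hi : ({j' ∈ Z | Function.update ρ j i₀ j' = i}) = ({j ∈ Z | ρ j = i}).erase j := by
    ext j'
    by_cases h : j' = j
    · subst h; simp [hne.symm]
    · simp [h]
  have hi0 : ({j' ∈ Z | Function.update ρ j i₀ j' = i₀}) =
      insert j ({j ∈ Z | ρ j = i₀}) := by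
    ext j'
    by_cases h : j' = j
    · subst h; simp [hjZ]
    · simp [h]
  have hci : #{j' ∈ Z | Function.update ρ j i₀ j' = i} = q := by
    rw [hi, Finset.card_erase_of_mem hj]; omega
  have hci0 : #{j' ∈ Z | Function.update ρ j i₀ j' = i₀} = #{j ∈ Z | ρ j = i₀} + 1 := by
    rw [hi0, Finset.card_insert_of_notMem (by simp [hji, hne])]
  have hsum := Finset.sum_eq_add_of_mem (s := Finset.univ)
    (f := fun t => bundleGain (x t) (#{j' ∈ Z | Function.update ρ j i₀ j' = t}) -
      bundleGain (x t) (#{j ∈ Z | ρ j = t})) i i₀ (Finset.mem_univ _) (Finset.mem_univ _) hne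
    (fun t _ ht => by simp [hcard t ht.1 ht.2])
  rw [Finset.sum_sub_distrib] at hsum
  simp only [hci, hci0, ← hq] at hsum
  push_cast at hsum ⊢
  linarith

lemma smoothValue_uniform {n m : ℕ} (hm : 0 < m) (A : Fin n → Fin m → ℝ)
    (B : PartitionScheme n m) (i : Fin n) (j : Fin m) :
    smoothValue A (fun _ => 1 / (m : ℝ)) B i j = (∑ l ∈ B.bundle i j, A i l) / #(B.bundle i j) := by
  have : (1 / (m : ℝ)) ≠ 0 := by positivity
  unfold smoothValue
  rw [← Finset.mul_sum, Finset.sum_const, nsmul_eq_mul, mul_comm (#(B.bundle i j) : ℝ),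
    mul_div_mul_left _ _ this]

lemma partitionValue_uniform {n m : ℕ} (A : Fin n → Fin m → ℝ) (B : PartitionScheme n m) :
    partitionValue A (fun _ => 1 / (m : ℝ)) B =
      1 / m * ∑ j, ⨆ i, smoothValue A (fun _ => 1 / (m : ℝ)) B i j := by
  rw [partitionValue, Finset.mul_sum]

lemma PartitionScheme.mem_bundle_comm {n m : ℕ} (B : PartitionScheme n m) (i : Fin n)
    (j l : Fin m) : l ∈ B.bundle i j ↔ j ∈ B.bundle i l := by
  constructor <;> intro h
  · rw [B.consistent i j l h]; exact B.mem_bundle i j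
  · rw [B.consistent i l j h]; exact B.mem_bundle i l

/-- Smoothing preserves weighted sums when the weights depend only on the smooth values. -/
lemma sum_mul_smoothValue {n m : ℕ} (hm : 0 < m) (A : Fin n → Fin m → ℝ)
    (B : PartitionScheme n m) (i : Fin n) (g : ℝ → ℝ) :
    ∑ j, g (smoothValue A (fun _ => 1 / (m : ℝ)) B i j) *
        smoothValue A (fun _ => 1 / (m : ℝ)) B i j =
      ∑ j, g (smoothValue A (fun _ => 1 / (m : ℝ)) B i j) * A i j := by
  have hv : ∀ j l, l ∈ B.bundle i j → smoothValue A (fun _ => 1 / (m : ℝ)) B i j =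
      smoothValue A (fun _ => 1 / (m : ℝ)) B i l := fun j l h => by
    unfold smoothValue; rw [B.consistent i j l h]
  have hterm : ∀ j, g (smoothValue A (fun _ => 1 / (m : ℝ)) B i j) *
        smoothValue A (fun _ => 1 / (m : ℝ)) B i j =
      ∑ l ∈ B.bundle i j, g (smoothValue A (fun _ => 1 / (m : ℝ)) B i l) * A i l /
        #(B.bundle i l) := fun j => by
    nth_rewrite 2 [smoothValue_uniform hm]
    rw [← mul_div_assoc, Finset.mul_sum, Finset.sum_div]
    exact Finset.sum_congr rfl fun l hl => by rw [hv j l hl, B.consistent i j l hl]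
  simp only [hterm]
  rw [Finset.sum_comm' (t' := Finset.univ) (s' := fun l => B.bundle i l)
    (fun j l => by simp [B.mem_bundle_comm i j l])]
  refine Finset.sum_congr rfl fun l _ => ?_
  have : (#(B.bundle i l) : ℝ) ≠ 0 := by
    exact_mod_cast (Finset.card_pos.2 ⟨l, B.mem_bundle i l⟩).ne'
  rw [Finset.sum_const, nsmul_eq_mul]
  field_simp

lemma smoothValue_mem_Icc {n m : ℕ} (hm : 0 < m) {A : Fin n → Fin m → ℝ}
    (hA : ∀ i j, A i j = 0 ∨ A i j = 1) (B : PartitionScheme n m) (i : Fin n) (j : Fin m) :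
    0 ≤ smoothValue A (fun _ => 1 / (m : ℝ)) B i j ∧
      smoothValue A (fun _ => 1 / (m : ℝ)) B i j ≤ 1 := by
  rw [smoothValue_uniform hm]
  have h0 : ∀ l, 0 ≤ A i l := fun l => by rcases hA i l with h | h <;> simp [h]
  have h1 : ∀ l, A i l ≤ 1 := fun l => by rcases hA i l with h | h <;> simp [h]
  refine ⟨div_nonneg (Finset.sum_nonneg fun l _ => h0 l) (Nat.cast_nonneg _), ?_⟩
  refine div_le_one_of_le₀ ?_ (Nat.cast_nonneg _)
  simpa using Finset.sum_le_sum (s := B.bundle i j) fun l _ => h1 l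

/-- The columns of `S` obtain from row `i` at most the number of ones of the row in `S` plus
the gain of joining the remaining ones with the zeros in `S`. -/
lemma sum_smoothValue_le {n m : ℕ} (hm : 0 < m) {A : Fin n → Fin m → ℝ}
    (hA : ∀ i j, A i j = 0 ∨ A i j = 1) (B : PartitionScheme n m) (i : Fin n)
    (S : Finset (Fin m)) :
    ∑ j ∈ S, smoothValue A (fun _ => 1 / (m : ℝ)) B i j ≤
      #{j ∈ S | A i j = 1} + bundleGain (#{j ∈ Sᶜ | A i j = 1}) (#{j ∈ S | A i j = 0}) := by
  obtain ⟨t, ht0, ht1, ht⟩ := exists_bundleGain_eq_quadratic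
    (Nat.cast_nonneg (α := ℝ) #{j ∈ Sᶜ | A i j = 1}) (Nat.cast_nonneg (α := ℝ) #{j ∈ S | A i j = 0})
  rw [ht]
  have hv := smoothValue_mem_Icc hm hA B i
  have hsum := sum_mul_smoothValue hm A B i
  set v := smoothValue A (fun _ => 1 / (m : ℝ)) B i
  set w : ℝ → ℝ := fun y => max 0 (y - 2 * t + t ^ 2) - max 0 (y - t ^ 2)
  have hpoint : ∀ j, (if j ∈ S then v j - (if A i j = 1 then 1 else t ^ 2) else
      -(if A i j = 1 then (1 - t) ^ 2 else 0)) ≤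
      w (v j) * A i j + max 0 (v j - t ^ 2) - (1 - t) ^ 2 * A i j := fun j => by
    have e1 := le_max_left 0 (v j - 2 * t + t ^ 2)
    have e2 := le_max_right 0 (v j - 2 * t + t ^ 2)
    have e3 := le_max_left 0 (v j - t ^ 2)
    have e4 := le_max_right 0 (v j - t ^ 2)
    simp only [w]
    rcases hA i j with h | h <;> by_cases hj : j ∈ S <;> simp only [h, hj, if_true, if_false] <;>
      norm_num
    all_goals linarith
  have hpoint' : ∀ j, w (v j) * v j + max 0 (v j - t ^ 2) - (1 - t) ^ 2 * v j ≤ 0 := fun j => by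
    obtain ⟨h0, h1⟩ := hv j
    simp only [w]
    rcases max_cases 0 (v j - 2 * t + t ^ 2) with ⟨e1, e1'⟩ | ⟨e1, e1'⟩ <;>
      rcases max_cases 0 (v j - t ^ 2) with ⟨e2, e2'⟩ | ⟨e2, e2'⟩ <;> rw [e1, e2]
    · nlinarith [sq_nonneg (1 - t)]
    · nlinarith [sq_nonneg (v j - t)]
    · nlinarith [sq_nonneg (1 - t)]
    · nlinarith [sq_nonneg t, mul_nonneg (sub_nonneg.2 h1) (sq_nonneg t)]
  have h1 := Finset.sum_le_sum (s := Finset.univ) fun j _ => hpoint j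
  have h2 := Finset.sum_nonpos (s := Finset.univ) fun j _ => hpoint' j
  have h3 := hsum w
  have h4 := hsum fun _ => (1 - t) ^ 2
  simp only [Finset.sum_add_distrib, Finset.sum_sub_distrib] at h1 h2
  have h5 : ∑ j, (if j ∈ S then v j - (if A i j = 1 then 1 else t ^ 2) else
      -(if A i j = 1 then (1 - t) ^ 2 else 0)) = ∑ j ∈ S, v j - (#{j ∈ S | A i j = 1} : ℝ) -
      t ^ 2 * #{j ∈ S | A i j = 0} - (1 - t) ^ 2 * #{j ∈ Sᶜ | A i j = 1} := by
    rw [Finset.sum_ite, Finset.filter_mem_eq_inter, Finset.univ_inter, Finset.sum_sub_distrib,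
      Finset.sum_neg_distrib, Finset.sum_ite, Finset.sum_ite]
    have f1 : ({j | j ∉ S} : Finset (Fin m)) = Sᶜ := by ext; simp
    have f2 : ({j ∈ S | ¬ A i j = 1}) = {j ∈ S | A i j = 0} := by
      refine Finset.filter_congr fun j _ => ?_
      rcases hA i j with h | h <;> simp [h]
    rw [f1, f2]
    simp
    ring
  linarith

/-- The scheme whose row `i` has the bundle `M i` and otherwise only singletons. -/
def PartitionScheme.ofSets {n m : ℕ} (M : Fin n → Finset (Fin m)) : PartitionScheme n m where
  bundle i j := if j ∈ M i then M i else {j}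
  mem_bundle i j := by split_ifs with h <;> simp [h]
  consistent i j j' h := by
    split_ifs at h with hj
    · simp [h, hj]
    · obtain rfl := Finset.mem_singleton.1 h
      rfl

lemma le_partition_sum {n m : ℕ} (hm : 0 < m) {A : Fin n → Fin m → ℝ}
    (hA : ∀ i j, A i j = 0 ∨ A i j = 1) {C : Finset (Fin n × Fin m)}
    (hC2 : ∀ j : Fin m, (∃ i, A i j = 1) → ∃! i : Fin n, (i, j) ∈ C)
    {B : PartitionScheme n m} (hC1 : ∀ q ∈ C, A q.1 q.2 = 1)
    (hB : ∀ q ∈ C, B.bundle q.1 q.2 = {q.2}) (Z : Finset (Fin m))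
    (hZ : ∀ j, j ∈ Z ↔ ∀ i, A i j = 0) (ρ : Fin m → Fin n) (x : Fin n → ℕ)
    (hρ : ∀ j ∈ Z, smoothValue A (fun _ => 1 / (m : ℝ)) B (ρ j) j =
      x (ρ j) / (x (ρ j) + #{l ∈ Z | ρ l = ρ j})) :
    #Zᶜ + ∑ i, bundleGain (x i) (#{j ∈ Z | ρ j = i}) ≤
      ∑ j, ⨆ i, smoothValue A (fun _ => 1 / (m : ℝ)) B i j := by
  have hle : ∀ i j, smoothValue A (fun _ => 1 / (m : ℝ)) B i j ≤
      ⨆ i, smoothValue A (fun _ => 1 / (m : ℝ)) B i j := fun i j =>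
    le_ciSup (f := fun i => smoothValue A (fun _ => 1 / (m : ℝ)) B i j)
      (Set.finite_range _).bddAbove i
  rw [← Finset.sum_add_sum_compl Z, add_comm]
  refine add_le_add ?_ ?_
  · rw [← Finset.sum_fiberwise Z ρ]
    refine Finset.sum_le_sum fun i _ => ?_
    calc bundleGain (x i) (#{j ∈ Z | ρ j = i})
        = ∑ j ∈ Z with ρ j = i, (x i : ℝ) / (x i + #{l ∈ Z | ρ l = i}) := by
          rw [Finset.sum_const, nsmul_eq_mul, bundleGain]; ring
      _ ≤ _ := Finset.sum_le_sum fun j hj => by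
          obtain ⟨hjZ, rfl⟩ := Finset.mem_filter.1 hj
          rw [← hρ j hjZ]
          exact hle _ _
  · rw [Finset.card_eq_sum_ones, Nat.cast_sum]
    refine Finset.sum_le_sum fun j hj => ?_
    have : ∃ i, A i j = 1 := by
      rw [Finset.mem_compl, hZ] at hj
      push Not at hj
      exact hj.imp fun i hi => (hA i j).resolve_left hi
    obtain ⟨i, hi, -⟩ := hC2 j this
    refine le_trans (le_of_eq ?_) (hle i j)
    rw [smoothValue_uniform hm, hB _ hi]
    simp [hC1 _ hi]

/-- For every uniform instance and every full cover `C` of the one-columns,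
the maximum partition value over partition schemes containing `C` is at least `9/10` times
the maximum partition value over all partition schemes. -/
theorem greedy_nine_tenths_approx {n m : ℕ} (hn : 0 < n) (hm : 0 < m)
    (A : Fin n → Fin m → ℝ) (hA : ∀ i j, A i j = 0 ∨ A i j = 1)
    (C : Finset (Fin n × Fin m))
    (hC1 : ∀ q ∈ C, A q.1 q.2 = 1)
    (hC2 : ∀ j : Fin m, (∃ i, A i j = 1) → ∃! i : Fin n, (i, j) ∈ C) :
    ∃ B : PartitionScheme n m,
      (∀ q ∈ C, B.bundle q.1 q.2 = {q.2}) ∧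
      (∀ B' : PartitionScheme n m,
        partitionValue A (fun _ => 1 / m) B ≥
          (9 / 10) * partitionValue A (fun _ => 1 / m) B') := by
  have : Nonempty (Fin n) := ⟨⟨0, hn⟩⟩
  obtain ⟨Z, hZ⟩ : ∃ Z : Finset (Fin m), ∀ j, j ∈ Z ↔ ∀ i, A i j = 0 :=
    ⟨Finset.univ.filter fun j => ∀ i, A i j = 0, by simp⟩
  obtain ⟨x, hx⟩ : ∃ x : Fin n → ℕ, ∀ i, x i = #{j | A i j = 1 ∧ (i, j) ∉ C} := ⟨_, fun _ => rfl⟩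
  obtain ⟨c, hc⟩ : ∃ c : Fin n → ℕ, ∀ i, c i = #{j | (i, j) ∈ C} := ⟨_, fun _ => rfl⟩
  obtain ⟨ρ, a, ha0, ha1, hopt⟩ := exists_optimal_assignment Z x
  obtain ⟨q, hqa, hq⟩ := exists_price ha0 ha1
  set M : Fin n → Finset (Fin m) := fun i =>
    ({j | A i j = 1 ∧ (i, j) ∉ C} : Finset (Fin m)) ∪ {j ∈ Z | ρ j = i}
  have hM : ∀ i, #(M i) = x i + #{j ∈ Z | ρ j = i} := fun i => by
    rw [hx, ← Finset.card_union_of_disjoint]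
    refine Finset.disjoint_left.2 fun j h1 h2 => ?_
    simp only [Finset.mem_filter, Finset.mem_univ, true_and] at h1 h2
    have := (hZ j).1 h2.1 i
    rw [h1.1] at this
    exact one_ne_zero this
  have hMsum : ∀ i, ∑ l ∈ M i, A i l = x i := fun i => by
    have h1 : ∀ l, A i l = if A i l = 1 then 1 else 0 := fun l => by
      rcases hA i l with h | h <;> simp [h]
    rw [Finset.sum_congr rfl fun l _ => h1 l, Finset.sum_boole, hx]
    congr 2
    ext l
    simp only [M, Finset.mem_filter, Finset.mem_union, Finset.mem_univ, true_and]
    constructor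
    · rintro ⟨h | h, h'⟩
      · exact h
      · rw [(hZ l).1 h.1 i] at h'; norm_num at h'
    · exact fun h => ⟨Or.inl h, h.1⟩
  have hB : ∀ p ∈ C, (PartitionScheme.ofSets M).bundle p.1 p.2 = {p.2} := fun p hp => by
    refine if_neg fun h => ?_
    simp only [M, Finset.mem_filter, Finset.mem_union, Finset.mem_univ, true_and] at h
    rcases h with h | h
    · exact h.2 hp
    · have := (hZ _).1 h.1 p.1
      rw [hC1 p hp] at this
      exact one_ne_zero this
  refine ⟨PartitionScheme.ofSets M, hB, fun B' => ?_⟩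
  have hlow := le_partition_sum hm hA hC2 hC1 hB Z hZ ρ x fun j hj => by
    have hjM : j ∈ M (ρ j) := Finset.mem_union_right _ (by simp [hj])
    have hb : (PartitionScheme.ofSets M).bundle (ρ j) j = M (ρ j) := if_pos hjM
    rw [smoothValue_uniform hm, hb, hMsum, hM]
    push_cast
    rfl
  have hexφ : ∀ j, ∃ i, smoothValue A (fun _ => 1 / (m : ℝ)) B' i j =
      ⨆ i, smoothValue A (fun _ => 1 / (m : ℝ)) B' i j := fun j => exists_eq_ciSup_of_finite
  choose φ hφ using hexφ
  obtain ⟨S, hS⟩ : ∃ S : Fin n → Finset (Fin m), ∀ i, S i = ({j | φ j = i} : Finset (Fin m)) :=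
    ⟨_, fun _ => rfl⟩
  have hup : ∑ j, ⨆ i, smoothValue A (fun _ => 1 / (m : ℝ)) B' i j ≤
      ∑ i, ((#{j ∈ S i | A i j = 1} : ℝ) +
        bundleGain (#{j ∈ (S i)ᶜ | A i j = 1}) (#{j ∈ S i | A i j = 0})) := by
    rw [← Finset.sum_fiberwise Finset.univ φ]
    refine Finset.sum_le_sum fun i _ => le_trans (le_of_eq ?_) (sum_smoothValue_le hm hA B' i (S i))
    rw [hS]
    refine Finset.sum_congr rfl fun j hj => ?_
    rw [← hφ j, (Finset.mem_filter.1 hj).2]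
  have hcount : ∀ i, x i + c i = #{j ∈ (S i)ᶜ | A i j = 1} + #{j ∈ S i | A i j = 1} := fun i => by
    have e1 : #{j | A i j = 1} = x i + c i := by
      rw [hx, hc, ← Finset.card_filter_add_card_filter_not (s := {j | A i j = 1})
        (fun j => (i, j) ∉ C), Finset.filter_filter, Finset.filter_filter]
      congr 2
      ext j
      simp only [Finset.mem_filter, Finset.mem_univ, true_and, not_not]
      exact ⟨fun h => h.2, fun h => ⟨hC1 _ h, h⟩⟩
    rw [← e1, add_comm, ← Finset.card_union_of_disjoint, ← Finset.filter_union, Finset.union_compl]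
    exact Finset.disjoint_filter_filter disjoint_compl_right
  have hrow := Finset.sum_le_sum (s := Finset.univ) fun i _ =>
    hq (x i) (c i) #{j ∈ (S i)ᶜ | A i j = 1} #{j ∈ S i | A i j = 1} #{j ∈ S i | A i j = 0} _
      (hcount i) (hopt i)
  have hcsum : ∑ i, (c i : ℝ) = #Zᶜ := by
    have : ∑ i, c i = #Zᶜ := by
      simp only [hc, Finset.card_filter]
      rw [Finset.sum_comm, Finset.card_eq_sum_ones, ← Finset.sum_add_sum_compl Z,
        Finset.sum_eq_zero, zero_add]
      · refine Finset.sum_congr rfl fun j hj => ?_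
        rw [Finset.mem_compl, hZ] at hj
        push Not at hj
        obtain ⟨i, hi, hiu⟩ := hC2 j (hj.imp fun i hi => (hA i j).resolve_left hi)
        rw [Finset.sum_eq_single i (fun i' _ h => if_neg fun h' => h (hiu i' h')) (by simp),
          if_pos hi]
      · intro j hj
        refine Finset.sum_eq_zero fun i _ => if_neg fun h => ?_
        have := hC1 _ h
        rw [(hZ j).1 hj i] at this
        exact zero_ne_one this
    exact_mod_cast this
  have hZc : (#Z : ℝ) + #Zᶜ = m := by
    have := Finset.card_add_card_compl Z
    rw [Fintype.card_fin] at this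
    exact_mod_cast this
  have hlsum : ∑ i, (#{j ∈ Z | ρ j = i} : ℝ) = #Z := by
    have := Finset.card_eq_sum_card_fiberwise (f := ρ) (s := Z) (t := Finset.univ) (by simp)
    exact_mod_cast this.symm
  have hksum : ∑ i, (#{j ∈ S i | A i j = 1} : ℝ) + ∑ i, (#{j ∈ S i | A i j = 0} : ℝ) = m := by
    have h1 := Finset.card_eq_sum_card_fiberwise (f := φ) (s := Finset.univ) (t := Finset.univ)
      (by simp)
    rw [Finset.card_univ, Fintype.card_fin] at h1
    rw [← Finset.sum_add_distrib]
    conv_rhs => rw [h1]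
    push_cast
    refine Finset.sum_congr rfl fun i _ => ?_
    rw [← hS, ← Finset.card_filter_add_card_filter_not (s := S i) (fun j => A i j = 1)]
    push_cast
    congr 3
    refine Finset.filter_congr fun j _ => ?_
    rcases hA i j with h | h <;> simp [h]
  have hones : ∑ i, (#{j ∈ S i | A i j = 1} : ℝ) ≤ #Zᶜ := by
    have : ∑ i, #{j ∈ S i | A i j = 1} ≤ #Zᶜ := by
      rw [Finset.card_eq_sum_card_fiberwise (f := φ) (s := Zᶜ) (t := Finset.univ) (by simp)]
      refine Finset.sum_le_sum fun i _ => Finset.card_le_card fun j hj => ?_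
      simp only [hS, Finset.mem_filter, Finset.mem_univ, true_and, Finset.mem_compl, hZ] at hj ⊢
      refine ⟨fun h => ?_, hj.1⟩
      rw [h i] at hj
      exact zero_ne_one hj.2
    exact_mod_cast this
  simp only [Finset.sum_add_distrib, Finset.sum_sub_distrib, ← Finset.mul_sum] at hrow hup
  rw [hcsum, hlsum] at hrow
  rw [partitionValue_uniform, partitionValue_uniform, ge_iff_le, mul_left_comm]
  refine mul_le_mul_of_nonneg_left ?_ (by positivity)
  nlinarith [mul_nonneg (sub_nonneg.2 hqa) (sub_nonneg.2 hones)]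
end

section
/- For every ε > 0, there exists an instance of the asymmetric binary matrix partition problem (with a non-uniform probability distribution) such that every partition scheme that fully covers the set A^+ of one-columns has partition value at most (8/9 + ε) times the maximum partition value over all partition schemes. -/
open Finset

theorem PartitionScheme.bundle_injective {n m : ℕ} :
    Function.Injective (PartitionScheme.bundle : PartitionScheme n m → _) := by
  rintro ⟨b, _, _⟩ ⟨b', _, _⟩ h
  cases h
  rfl

instance {n m : ℕ} : Finite (PartitionScheme n m) :=
  Finite.of_injective _ PartitionScheme.bundle_injective

/-- The partition scheme whose bundles in row `i` are the fibres of `c i`. -/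
def PartitionScheme.ofLabels {n m : ℕ} (c : Fin n → Fin m → ℕ) : PartitionScheme n m where
  bundle i j := univ.filter fun k => c i k = c i j
  mem_bundle i j := by simp
  consistent i j j' h := by
    simp only [mem_filter, mem_univ, true_and] at h
    simp only [h]

theorem smoothValue_le_one {n m : ℕ} {A : Fin n → Fin m → ℝ} {p : Fin m → ℝ}
    (hA : ∀ i j, A i j ≤ 1) (hp : ∀ j, 0 ≤ p j) (B : PartitionScheme n m) (i : Fin n)
    (j : Fin m) : smoothValue A p B i j ≤ 1 :=
  div_le_one_of_le₀ (sum_le_sum fun ℓ _ => mul_le_of_le_one_right (hp ℓ) (hA i ℓ))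
    (sum_nonneg fun ℓ _ => hp ℓ)

theorem smoothValue_le_iSup {n m : ℕ} (A : Fin n → Fin m → ℝ) (p : Fin m → ℝ)
    (B : PartitionScheme n m) (i : Fin n) (j : Fin m) :
    smoothValue A p B i j ≤ ⨆ i, smoothValue A p B i j :=
  le_ciSup (f := fun i => smoothValue A p B i j) (Set.finite_range _).bddAbove i

/-- A matrix for which fully covering the one-columns is suboptimal: column `1` can only be covered
in row `1`, where it is more useful in a bundle with the zero column `2`. -/
def gapMatrix : Fin 3 → Fin 3 → ℝ := ![![1, 0, 0], ![1, 1, 0], ![1, 0, 0]]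

/-- The column distribution accompanying `gapMatrix`. -/
noncomputable def gapWeight : Fin 3 → ℝ := ![1 / 40, 1 / 40, 38 / 40]

theorem gapWeight_zero : gapWeight 0 = 1 / 40 := rfl

theorem gapWeight_one : gapWeight 1 = 1 / 40 := rfl

theorem gapWeight_two : gapWeight 2 = 38 / 40 := rfl

/-- A good scheme for `gapMatrix` that leaves column `1` uncovered. -/
def gapScheme : PartitionScheme 3 3 :=
  PartitionScheme.ofLabels ![![0, 0, 1], ![0, 0, 0], ![0, 1, 2]]

theorem gapMatrix_eq_zero_or_one (i j : Fin 3) : gapMatrix i j = 0 ∨ gapMatrix i j = 1 := by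
  fin_cases i <;> fin_cases j <;> simp [gapMatrix]

theorem gapWeight_nonneg (j : Fin 3) : 0 ≤ gapWeight j := by
  fin_cases j <;> norm_num [gapWeight]

theorem le_partitionValue_gapScheme :
    (17 / 200 : ℝ) ≤ partitionValue gapMatrix gapWeight gapScheme := by
  have h0 : (1 : ℝ) ≤ ⨆ i, smoothValue gapMatrix gapWeight gapScheme i 0 := by
    refine le_trans (le_of_eq ?_) (smoothValue_le_iSup _ _ _ 2 0)
    have hb : gapScheme.bundle 2 0 = {0} := by decide
    norm_num [smoothValue, hb, gapMatrix, gapWeight_zero, gapWeight_one, gapWeight_two,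
      Fin.sum_univ_three]
    rfl
  have h1 : (1 / 2 : ℝ) ≤ ⨆ i, smoothValue gapMatrix gapWeight gapScheme i 1 := by
    refine le_trans (le_of_eq ?_) (smoothValue_le_iSup _ _ _ 0 1)
    have hb : gapScheme.bundle 0 1 = {0, 1} := by decide
    norm_num [smoothValue, hb, gapMatrix, gapWeight_zero, gapWeight_one, gapWeight_two,
      Fin.sum_univ_three]
  have h2 : (1 / 20 : ℝ) ≤ ⨆ i, smoothValue gapMatrix gapWeight gapScheme i 2 := by
    refine le_trans (le_of_eq ?_) (smoothValue_le_iSup _ _ _ 1 2)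
    have hb : gapScheme.bundle 1 2 = univ := by decide
    norm_num [smoothValue, hb, gapMatrix, gapWeight_zero, gapWeight_one, gapWeight_two,
      Fin.sum_univ_three]
    rfl
  simp only [partitionValue, Fin.sum_univ_three, gapWeight_zero, gapWeight_one, gapWeight_two]
  linarith

theorem smoothValue_gap_two_le {B : PartitionScheme 3 3} (hB : FullyCovers gapMatrix B)
    (i : Fin 3) : smoothValue gapMatrix gapWeight B i 2 ≤ 1 / 38 := by
  have hsingle : B.bundle 1 1 = {1} := by
    obtain ⟨i, hi, h⟩ := hB 1 ⟨1, by simp [gapMatrix]⟩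
    fin_cases i <;> simp_all [gapMatrix]
  have hnot : (1 : Fin 3) ∉ B.bundle 1 2 := by
    intro h
    have h2 := B.mem_bundle 1 2
    rw [← B.consistent 1 2 1 h, hsingle] at h2
    simp at h2
  have hnum : ∑ ℓ ∈ B.bundle i 2, gapWeight ℓ * gapMatrix i ℓ ≤ 1 / 40 := by
    rw [← univ_inter (B.bundle i 2), ← sum_ite_mem, Fin.sum_univ_three]
    fin_cases i <;> (simp [gapMatrix, gapWeight, hnot]; split_ifs <;> norm_num)
  have hden : 38 / 40 ≤ ∑ ℓ ∈ B.bundle i 2, gapWeight ℓ :=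
    le_trans (by simp [gapWeight])
      (single_le_sum (fun ℓ _ => gapWeight_nonneg ℓ) (B.mem_bundle i 2))
  rw [smoothValue, div_le_iff₀ (by linarith)]
  linarith

theorem partitionValue_gap_le {B : PartitionScheme 3 3} (hB : FullyCovers gapMatrix B) :
    partitionValue gapMatrix gapWeight B ≤ 3 / 40 := by
  have hA (i j) : gapMatrix i j ≤ 1 := by
    rcases gapMatrix_eq_zero_or_one i j with h | h <;> rw [h] <;> norm_num
  have h0 := ciSup_le fun i => smoothValue_le_one hA gapWeight_nonneg B i 0
  have h1 := ciSup_le fun i => smoothValue_le_one hA gapWeight_nonneg B i 1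
  have h2 := ciSup_le fun i => smoothValue_gap_two_le hB i
  simp only [partitionValue, Fin.sum_univ_three, gapWeight_zero, gapWeight_one, gapWeight_two]
  linarith

/-- For every ε > 0 there is an instance of asymmetric binary matrix
partition in which every partition scheme that fully covers the one-columns has
partition value at most (8/9 + ε) times the maximum partition value. -/
theorem full_cover_not_optimal_non_uniform :
    ∀ ε : ℝ, 0 < ε →
      ∃ (n m : ℕ) (A : Fin n → Fin m → ℝ) (p : Fin m → ℝ),
        0 < n ∧ 0 < m ∧
        (∀ i j, A i j = 0 ∨ A i j = 1) ∧
        (∀ j, 0 ≤ p j) ∧ (∑ j, p j) = 1 ∧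
        ∃ Bopt : PartitionScheme n m,
          (∀ B : PartitionScheme n m, partitionValue A p B ≤ partitionValue A p Bopt) ∧
          (∀ B : PartitionScheme n m, FullyCovers A B →
            partitionValue A p B ≤ (8 / 9 + ε) * partitionValue A p Bopt) := by
  intro ε hε
  have : Nonempty (PartitionScheme 3 3) := ⟨gapScheme⟩
  obtain ⟨Bopt, hopt⟩ := Finite.exists_max (partitionValue gapMatrix gapWeight)
  refine ⟨3, 3, gapMatrix, gapWeight, by norm_num, by norm_num, gapMatrix_eq_zero_or_one,
    gapWeight_nonneg, ?_, Bopt, hopt, fun B hB => ?_⟩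
  · norm_num [gapWeight_zero, gapWeight_one, gapWeight_two, Fin.sum_univ_three]
  · have hfull := partitionValue_gap_le hB
    have hlarge := le_partitionValue_gapScheme.trans (hopt gapScheme)
    nlinarith
end

section
/- For every ε > 0, there exists an instance of the asymmetric binary matrix partition problem and a full cover C of the set A^+ of one-columns such that every partition scheme containing C has partition value at most (1/2 + ε) times the maximum partition value over all partition schemes. (This witnesses the tightness of the 1/2-approximation guarantee of the greedy algorithm in the non-uniform case.) -/
open Finset

namespace PartitionScheme

variable {n m : ℕ}

theorem bundle_injective_s4 : Function.Injective (bundle : PartitionScheme n m → _) := by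
  rintro ⟨b, _, _⟩ ⟨c, _, _⟩ h
  simpa using h

instance : Finite (PartitionScheme n m) := Finite.of_injective _ bundle_injective_s4

theorem smoothValue_le_one {A : Fin n → Fin m → ℝ} {p : Fin m → ℝ} (hA : ∀ i j, A i j ≤ 1)
    (hp : ∀ j, 0 ≤ p j) (B : PartitionScheme n m) (i : Fin n) (j : Fin m) :
    smoothValue A p B i j ≤ 1 :=
  div_le_one_of_le₀
    (Finset.sum_le_sum fun ℓ _ => mul_le_of_le_one_right (hp ℓ) (hA i ℓ))
    (Finset.sum_nonneg fun ℓ _ => hp ℓ)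

/-- The contribution of column `j` through row `i` is at most the mass of ones in its bundle. -/
theorem mul_smoothValue_le {A : Fin n → Fin m → ℝ} {p : Fin m → ℝ} (hA : ∀ i j, 0 ≤ A i j)
    (hp : ∀ j, 0 ≤ p j) (B : PartitionScheme n m) (i : Fin n) (j : Fin m) :
    p j * smoothValue A p B i j ≤ ∑ ℓ ∈ B.bundle i j, p ℓ * A i ℓ := by
  have hle : p j ≤ ∑ ℓ ∈ B.bundle i j, p ℓ :=
    Finset.single_le_sum (f := p) (fun ℓ _ => hp ℓ) (B.mem_bundle i j)
  have hnum : 0 ≤ ∑ ℓ ∈ B.bundle i j, p ℓ * A i ℓ :=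
    Finset.sum_nonneg fun ℓ _ => mul_nonneg (hp ℓ) (hA i ℓ)
  rw [smoothValue, mul_div_assoc', mul_comm, mul_div_assoc]
  exact mul_le_of_le_one_right hnum (div_le_one_of_le₀ hle ((hp j).trans hle))

end PartitionScheme

/-- Column `0` is zero, row `0` is one on all other columns, and row `i ≠ 0` is the indicator of
column `i`. -/
def borderedIdentity (N : ℕ) (i j : Fin (N + 1)) : ℝ :=
  if j ≠ 0 ∧ (i = 0 ∨ i = j) then 1 else 0

/-- Mass `1 / N ^ 2` on each of the `N` nonzero columns, the rest on column `0`. -/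
noncomputable def borderedWeight (N : ℕ) : Fin (N + 1) → ℝ :=
  Fin.cons (1 - 1 / N) fun _ => 1 / (N : ℝ) ^ 2

/-- The scheme bundling everything in row `0` and nothing in the other rows. -/
def bundleFirstRow (N : ℕ) : PartitionScheme (N + 1) (N + 1) where
  bundle i j := if i = 0 then Finset.univ else {j}
  mem_bundle i j := by split_ifs <;> simp
  consistent i j j' h := by
    split_ifs at h ⊢
    · rfl
    · simpa using h

theorem borderedIdentity_eq_zero_or_one (N : ℕ) (i j : Fin (N + 1)) :
    borderedIdentity N i j = 0 ∨ borderedIdentity N i j = 1 := by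
  unfold borderedIdentity
  split_ifs <;> simp

theorem borderedIdentity_nonneg (N : ℕ) (i j : Fin (N + 1)) : 0 ≤ borderedIdentity N i j := by
  rcases borderedIdentity_eq_zero_or_one N i j with h | h <;> simp [h]

theorem borderedIdentity_le_one (N : ℕ) (i j : Fin (N + 1)) : borderedIdentity N i j ≤ 1 := by
  rcases borderedIdentity_eq_zero_or_one N i j with h | h <;> simp [h]

theorem borderedWeight_nonneg {N : ℕ} (hN : 0 < N) (j : Fin (N + 1)) :
    0 ≤ borderedWeight N j := by
  have h : (1 : ℝ) ≤ N := by exact_mod_cast hN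
  refine Fin.cases ?_ (fun k => ?_) j
  · simpa [borderedWeight] using inv_le_one_of_one_le₀ h
  · simp [borderedWeight]

theorem sum_borderedWeight {N : ℕ} (hN : 0 < N) : ∑ j, borderedWeight N j = 1 := by
  have h : (N : ℝ) ≠ 0 := by exact_mod_cast hN.ne'
  simp only [borderedWeight, Fin.sum_univ_succ, Fin.cons_zero, Fin.cons_succ, Finset.sum_const,
    Finset.card_univ, Fintype.card_fin, nsmul_eq_mul]
  field_simp
  ring

theorem le_partitionValue_bundleFirstRow {N : ℕ} (hN : 0 < N) :
    2 / (N : ℝ) - 1 / (N : ℝ) ^ 2 ≤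
      partitionValue (borderedIdentity N) (borderedWeight N) (bundleFirstRow N) := by
  have h : (N : ℝ) ≠ 0 := by exact_mod_cast hN.ne'
  have hbdd (j : Fin (N + 1)) : BddAbove (Set.range fun i =>
      smoothValue (borderedIdentity N) (borderedWeight N) (bundleFirstRow N) i j) :=
    (Set.finite_range _).bddAbove
  have hzero : smoothValue (borderedIdentity N) (borderedWeight N) (bundleFirstRow N) 0 0 =
      1 / N := by
    simp only [smoothValue, bundleFirstRow, if_true, sum_borderedWeight hN, div_one]
    simp only [borderedIdentity, borderedWeight, Fin.sum_univ_succ]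
    simp
    field_simp
  have hsucc (k : Fin N) :
      smoothValue (borderedIdentity N) (borderedWeight N) (bundleFirstRow N) k.succ k.succ =
        1 := by
    simp [smoothValue, bundleFirstRow, borderedIdentity, borderedWeight, h]
  calc 2 / (N : ℝ) - 1 / (N : ℝ) ^ 2
      = (1 - 1 / N) * (1 / N) + ∑ _k : Fin N, 1 / (N : ℝ) ^ 2 * 1 := by
        simp only [Finset.sum_const, Finset.card_univ, Fintype.card_fin, nsmul_eq_mul]
        field_simp
        ring
    _ = borderedWeight N 0 *
          smoothValue (borderedIdentity N) (borderedWeight N) (bundleFirstRow N) 0 0 +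
        ∑ k : Fin N, borderedWeight N k.succ *
          smoothValue (borderedIdentity N) (borderedWeight N) (bundleFirstRow N)
            k.succ k.succ := by
        simp only [hzero, hsucc]
        rfl
    _ ≤ _ := by
        rw [partitionValue, Fin.sum_univ_succ]
        exact add_le_add
          (mul_le_mul_of_nonneg_left (le_ciSup (hbdd 0) 0) (borderedWeight_nonneg hN 0))
          (Finset.sum_le_sum fun k _ => mul_le_mul_of_nonneg_left
            (le_ciSup (hbdd k.succ) k.succ) (borderedWeight_nonneg hN k.succ))

theorem sum_bundle_zero_le {N : ℕ} (B : PartitionScheme (N + 1) (N + 1))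
    (hB : ∀ k : Fin N, B.bundle 0 k.succ = {k.succ}) (i : Fin (N + 1)) :
    ∑ ℓ ∈ B.bundle i 0, borderedWeight N ℓ * borderedIdentity N i ℓ ≤ 1 / (N : ℝ) ^ 2 := by
  refine Fin.cases ?_ (fun k => ?_) i
  · refine (Finset.sum_nonpos fun ℓ hℓ => ?_).trans (by positivity)
    induction ℓ using Fin.cases with
    | zero => simp [borderedIdentity]
    | succ k =>
      have h0 := B.mem_bundle 0 0
      rw [← B.consistent 0 0 _ hℓ, hB, Finset.mem_singleton] at h0
      exact absurd h0.symm (Fin.succ_ne_zero k)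
  · have hterm (ℓ : Fin (N + 1)) : borderedWeight N ℓ * borderedIdentity N k.succ ℓ =
        if k.succ = ℓ then 1 / (N : ℝ) ^ 2 else 0 := by
      by_cases hℓ : k.succ = ℓ
      · subst hℓ
        simp [borderedWeight, borderedIdentity]
      · simp [borderedIdentity, hℓ]
    simp only [hterm, Finset.sum_ite_eq]
    split_ifs
    · exact le_rfl
    · positivity

theorem partitionValue_le_of_cover_first_row {N : ℕ} (hN : 0 < N)
    (B : PartitionScheme (N + 1) (N + 1)) (hB : ∀ k : Fin N, B.bundle 0 k.succ = {k.succ}) :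
    partitionValue (borderedIdentity N) (borderedWeight N) B ≤
      1 / (N : ℝ) + 1 / (N : ℝ) ^ 2 := by
  have h : (N : ℝ) ≠ 0 := by exact_mod_cast hN.ne'
  have hfirst : borderedWeight N 0 *
      ⨆ i, smoothValue (borderedIdentity N) (borderedWeight N) B i 0 ≤ 1 / (N : ℝ) ^ 2 := by
    rw [Real.mul_iSup_of_nonneg (borderedWeight_nonneg hN 0)]
    exact ciSup_le fun i => (B.mul_smoothValue_le (borderedIdentity_nonneg N)
      (borderedWeight_nonneg hN) i 0).trans (sum_bundle_zero_le B hB i)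
  have hrest (k : Fin N) : borderedWeight N k.succ *
      ⨆ i, smoothValue (borderedIdentity N) (borderedWeight N) B i k.succ ≤
        1 / (N : ℝ) ^ 2 :=
    mul_le_of_le_one_right (borderedWeight_nonneg hN k.succ) (ciSup_le fun i =>
      B.smoothValue_le_one (borderedIdentity_le_one N) (borderedWeight_nonneg hN) i k.succ)
  have hsum := Finset.sum_le_sum fun k (_ : k ∈ Finset.univ) => hrest k
  have hconst : ∑ _k : Fin N, 1 / (N : ℝ) ^ 2 = 1 / (N : ℝ) := by
    simp only [Finset.sum_const, Finset.card_univ, Fintype.card_fin, nsmul_eq_mul]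
    field_simp
  rw [partitionValue, Fin.sum_univ_succ]
  linarith

/-- For every ε > 0 there is an instance and a full cover C of the
one-columns such that every partition scheme containing C has partition value at
most (1/2 + ε) times the maximum partition value (tightness of the greedy
1/2-approximation in the non-uniform case). -/
theorem greedy_half_tightness :
    ∀ ε : ℝ, 0 < ε →
      ∃ (n m : ℕ) (A : Fin n → Fin m → ℝ) (p : Fin m → ℝ),
        0 < n ∧ 0 < m ∧
        (∀ i j, A i j = 0 ∨ A i j = 1) ∧
        (∀ j, 0 ≤ p j) ∧ (∑ j, p j) = 1 ∧
        ∃ C : Finset (Fin n × Fin m),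
          (∀ q ∈ C, A q.1 q.2 = 1) ∧
          (∀ j : Fin m, (∃ i, A i j = 1) → ∃! i : Fin n, (i, j) ∈ C) ∧
          ∃ Bopt : PartitionScheme n m,
            (∀ B : PartitionScheme n m, partitionValue A p B ≤ partitionValue A p Bopt) ∧
            (∀ B : PartitionScheme n m, (∀ q ∈ C, B.bundle q.1 q.2 = {q.2}) →
              partitionValue A p B ≤ (1 / 2 + ε) * partitionValue A p Bopt) := by
  intro ε hε
  obtain ⟨N, hNε⟩ := exists_nat_gt (2 / ε)
  have hNpos : (0 : ℝ) < N := (by positivity : 0 < 2 / ε).trans hNε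
  have hN : 0 < N := by exact_mod_cast hNpos
  obtain ⟨Bopt, hopt⟩ : ∃ Bopt : PartitionScheme (N + 1) (N + 1), ∀ B,
      partitionValue (borderedIdentity N) (borderedWeight N) B ≤
        partitionValue (borderedIdentity N) (borderedWeight N) Bopt :=
    haveI : Nonempty (PartitionScheme (N + 1) (N + 1)) := ⟨bundleFirstRow N⟩
    Finite.exists_max _
  refine ⟨N + 1, N + 1, borderedIdentity N, borderedWeight N, N.succ_pos, N.succ_pos,
    borderedIdentity_eq_zero_or_one N, borderedWeight_nonneg hN, sum_borderedWeight hN,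
    Finset.univ.image fun k : Fin N => (0, k.succ), ?_, ?_, Bopt, hopt, fun B hB => ?_⟩
  · simp [borderedIdentity]
  · rintro j ⟨i, hi⟩
    induction j using Fin.cases with
    | zero => simp [borderedIdentity] at hi
    | succ k => exact ⟨0, by simp, by simp +contextual⟩
  · have hupper := partitionValue_le_of_cover_first_row hN B fun k => hB (0, k.succ) (by simp)
    have hlower := (le_partitionValue_bundleFirstRow hN).trans (hopt _)
    refine hupper.trans (le_trans ?_ (mul_le_mul_of_nonneg_left hlower (by positivity)))
    have hεN : 2 < N * ε := (div_lt_iff₀ hε).1 hNε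
    have hN1 : (1 : ℝ) ≤ N := by exact_mod_cast hN
    have hdiff : (1 / 2 + ε) * (2 / (N : ℝ) - 1 / (N : ℝ) ^ 2) - (1 / N + 1 / (N : ℝ) ^ 2) =
        ((N * ε - 3 / 2) + ε * (N - 1)) / (N : ℝ) ^ 2 := by
      field_simp
      ring
    have hnonneg : 0 ≤ ((N * ε - 3 / 2) + ε * (N - 1)) / (N : ℝ) ^ 2 :=
      div_nonneg (add_nonneg (by linarith) (mul_nonneg hε.le (by linarith))) (by positivity)
    linarith
end

section
/- Let B be a partition scheme for an instance (A,p), let j* be a column and i* a row with A_{i*j*} = 1 and A^B_{i*j*} = max_i A^B_{ij*}, and let b be the bundle of B_{i*} containing j*, with b ≠ {j*} and Σ_{ℓ∈b\{j*}} p_ℓ > 0. Let B' be the partition scheme obtained from B by replacing b in B_{i*} with the two bundles {j*} and b\{j*} (all other partitions unchanged). Then v^{B'}(A,p) ≥ v^B(A,p). -/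
open Finset

/-- If A_{i*j*} = 1, the smooth value of column j* is maximized at row i*,
and b is the bundle of B_{i*} containing j* (with b ≠ {j*} and positive probability mass
on b \ {j*}), then splitting b into {j*} and b \ {j*} does not decrease the partition
value. -/
theorem split_bundle_not_decrease {n m : ℕ}
    (A : Fin n → Fin m → ℝ) (hA : ∀ i j, A i j = 0 ∨ A i j = 1)
    (p : Fin m → ℝ) (hp : ∀ j, 0 ≤ p j) (hp1 : (∑ j, p j) = 1)
    (B : PartitionScheme n m) (istar : Fin n) (jstar : Fin m)
    (hone : A istar jstar = 1)
    (hmax : ∀ i : Fin n, smoothValue A p B i jstar ≤ smoothValue A p B istar jstar)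
    (hb : B.bundle istar jstar ≠ {jstar})
    (hpos : 0 < ∑ ℓ ∈ (B.bundle istar jstar).erase jstar, p ℓ)
    (B' : PartitionScheme n m)
    (hB' : ∀ i j, B'.bundle i j =
      if i = istar then
        (if j = jstar then {jstar}
         else if j ∈ B.bundle istar jstar then (B.bundle istar jstar).erase jstar
         else B.bundle i j)
      else B.bundle i j) :
    partitionValue A p B' ≥ partitionValue A p B := by
  set b := B.bundle istar jstar with hbdef
  have hjb : jstar ∈ b := B.mem_bundle istar jstar
  have hQs := Finset.add_sum_erase b p hjb
  have hcs := Finset.add_sum_erase b (fun ℓ => p ℓ * A istar ℓ) hjb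
  simp only [hone, mul_one] at hcs
  set P := p jstar with hP
  set Q := ∑ ℓ ∈ b.erase jstar, p ℓ
  set c := ∑ ℓ ∈ b.erase jstar, p ℓ * A istar ℓ
  have hP0 : 0 ≤ P := hp jstar
  have hPQ : 0 < P + Q := by linarith
  have hcQ : c ≤ Q := by
    refine Finset.sum_le_sum fun ℓ _ => mul_le_of_le_one_right (hp ℓ) ?_
    rcases hA istar ℓ with h | h <;> norm_num [h]
  have hx : ∀ j ∈ b, smoothValue A p B istar j = (P + c) / (P + Q) := by
    intro j hj
    rw [smoothValue, B.consistent istar jstar j hj, ← hbdef, ← hcs, ← hQs]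
  have hy : ∀ j ∈ b.erase jstar, smoothValue A p B' istar j = c / Q := by
    intro j hj
    rw [Finset.mem_erase] at hj
    rw [smoothValue, hB', if_pos rfl, if_neg hj.1, if_pos hj.2]
  have hstar : P * smoothValue A p B' istar jstar = P := by
    rw [smoothValue, hB', if_pos rfl, if_pos rfl, Finset.sum_singleton, Finset.sum_singleton,
      hone, mul_one, ← hP, ← mul_div_assoc, mul_self_div_self]
  have hsame : ∀ i j, i ≠ istar ∨ j ∉ b → smoothValue A p B' i j = smoothValue A p B i j := by
    intro i j h
    have : B'.bundle i j = B.bundle i j := by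
      rw [hB']
      rcases h with h | h
      · rw [if_neg h]
      · have hne : j ≠ jstar := fun e => h (e ▸ hjb)
        rw [if_neg hne, if_neg h, ite_self]
    rw [smoothValue, smoothValue, this]
  have hyx : c / Q ≤ (P + c) / (P + Q) := by
    rw [div_le_div_iff₀ hpos hPQ]
    nlinarith
  have hle : ∀ i j, smoothValue A p B' i j ≤ ⨆ i, smoothValue A p B' i j :=
    fun i j => le_ciSup (f := fun i => smoothValue A p B' i j) (Set.finite_range _).bddAbove i
  have : Nonempty (Fin n) := ⟨istar⟩
  have hcol : ∀ j, p j * (⨆ i, smoothValue A p B i j) ≤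
      p j * (⨆ i, smoothValue A p B' i j) +
        if j ∈ b then p j * ((P + c) / (P + Q)) - p j * smoothValue A p B' istar j else 0 := by
    intro j
    split_ifs with hj
    · rw [← mul_sub, ← mul_add]
      refine mul_le_mul_of_nonneg_left (ciSup_le fun i => ?_) (hp j)
      by_cases hjs : j = jstar
      · subst hjs
        linarith [hmax i, hx j hj, hle istar j]
      · have hyj := hy j (Finset.mem_erase.2 ⟨hjs, hj⟩)
        by_cases hi : i = istar
        · subst hi
          linarith [hle i j, hx j hj]
        · linarith [hle i j, hsame i j (Or.inl hi)]
    · simp only [hsame _ j (Or.inr hj), add_zero, le_refl]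
  have hsum : ∑ j ∈ b, p j * smoothValue A p B' istar j = P + c := by
    rw [← Finset.add_sum_erase b _ hjb, hstar,
      Finset.sum_congr rfl fun j hj => by rw [hy j hj], ← Finset.sum_mul,
      mul_div_cancel₀ c hpos.ne']
  have hloss : (∑ j, if j ∈ b then
      p j * ((P + c) / (P + Q)) - p j * smoothValue A p B' istar j else 0) = 0 := by
    rw [Finset.sum_ite_mem, Finset.univ_inter, Finset.sum_sub_distrib, hsum, ← Finset.sum_mul,
      ← hQs, mul_div_cancel₀ _ hPQ.ne', sub_self]
  have h := Finset.sum_le_sum fun j (_ : j ∈ Finset.univ) => hcol j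
  rwa [Finset.sum_add_distrib, hloss, add_zero] at h
end

section
/- The set function R is non-decreasing: for all sets S, T ⊆ [m] with S ⊆ T, R(S) ≤ R(T). -/
open Finset

/-- The row-contribution function of the welfare-maximization reformulation of the
asymmetric binary matrix partition problem: `P` is the set of columns with a 1-entry in
the row, its complement plays the role of the set of columns with a 0-entry, and
`R S = α(S) + β(S)·γ(S)/(β(S)+γ(S))` with `α(S) = Σ_{j∈S∩P} p j`,
`β(S) = Σ_{j∈S\P} p j`, `γ(S) = Σ_{j∈P\S} p j` (the fraction being 0 when the
denominator vanishes, as is Lean's convention for division by zero). -/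
noncomputable def Rfun (m : ℕ) (p : Fin m → ℝ) (P : Finset (Fin m))
    (S : Finset (Fin m)) : ℝ :=
  (∑ j ∈ S ∩ P, p j) +
    (∑ j ∈ S \ P, p j) * (∑ j ∈ P \ S, p j) /
      ((∑ j ∈ S \ P, p j) + (∑ j ∈ P \ S, p j))

theorem mul_div_add_sub_le_of_le {b b' g g' : ℝ} (hb : 0 ≤ b) (hg' : 0 ≤ g') (hbb : b ≤ b')
    (hgg : g' ≤ g) : b * g / (b + g) - g ≤ b' * g' / (b' + g') - g' := by
  have key : ∀ x y : ℝ, 0 ≤ x → 0 ≤ y → x * y / (x + y) - y = -(y ^ 2 / (x + y)) := by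
    intro x y hx hy
    rcases (add_nonneg hx hy).eq_or_lt with h | h
    · have hy0 : y = 0 := by linarith
      simp [hy0]
    · field_simp
      ring
  have hg : 0 ≤ g := hg'.trans hgg
  have hb' : 0 ≤ b' := hb.trans hbb
  rw [key b g hb hg, key b' g' hb' hg', neg_le_neg_iff]
  rcases hg'.eq_or_lt with h | h
  · rw [← h]
    simp only [ne_eq, OfNat.ofNat_ne_zero, not_false_eq_true, zero_pow, zero_div]
    positivity
  · have hgpos : 0 < g := h.trans_le hgg
    rw [div_le_div_iff₀ (by positivity) (by positivity)]
    have h1 : g' ^ 2 * b ≤ g ^ 2 * b' := by gcongr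
    have h2 : g' * g * g' ≤ g' * g * g := by gcongr
    linarith

/-- The set function R is non-decreasing. -/
theorem Rfun_monotone (m : ℕ) (hm : 1 ≤ m) (p : Fin m → ℝ) (hp : ∀ j, 0 ≤ p j)
    (P : Finset (Fin m)) (S T : Finset (Fin m)) (hST : S ⊆ T) :
    Rfun m p P S ≤ Rfun m p P T := by
  have hβ : ∑ j ∈ S \ P, p j ≤ ∑ j ∈ T \ P, p j :=
    sum_le_sum_of_subset_of_nonneg (sdiff_subset_sdiff hST subset_rfl) fun j _ _ => hp j
  have hγ : ∑ j ∈ P \ T, p j ≤ ∑ j ∈ P \ S, p j :=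
    sum_le_sum_of_subset_of_nonneg (sdiff_subset_sdiff subset_rfl hST) fun j _ _ => hp j
  have hαγ : ∀ U : Finset (Fin m), ∑ j ∈ U ∩ P, p j + ∑ j ∈ P \ U, p j = ∑ j ∈ P, p j := by
    intro U
    rw [inter_comm]
    exact sum_inter_add_sum_sdiff P U p
  have h := mul_div_add_sub_le_of_le (sum_nonneg fun j _ => hp j) (sum_nonneg fun j _ => hp j) hβ hγ
  unfold Rfun
  linarith [hαγ S, hαγ T]
end

section
/- The set function R is submodular: for all sets S, T ⊆ [m] with S ⊆ T and every x ∈ [m] \ T, R(S ∪ {x}) − R(S) ≥ R(T ∪ {x}) − R(T). -/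
open Finset

/-- The increment of `b * g / (b + g)` in its first argument. -/
theorem mul_div_add_sub_mul_div_add {b g q : ℝ} (hb : 0 ≤ b) (hg : 0 ≤ g) (hq : 0 ≤ q) :
    (b + q) * g / (b + q + g) - b * g / (b + g) = q * (g / (b + g) * (g / (b + q + g))) := by
  rcases hg.eq_or_lt with rfl | hg
  · simp
  · have h₁ : b + g ≠ 0 := by positivity
    have h₂ : b + q + g ≠ 0 := by positivity
    field_simp
    ring

theorem div_add_le_div_add {b b' g g' : ℝ} (hb : 0 ≤ b) (hbb' : b ≤ b') (hg' : 0 ≤ g')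
    (hgg' : g' ≤ g) : g' / (b' + g') ≤ g / (b + g) := by
  rcases hg'.eq_or_lt with rfl | hg'
  · simp only [zero_div]
    positivity
  · have hg : 0 < g := hg'.trans_le hgg'
    rw [div_le_div_iff₀ (by linarith) (by linarith)]
    nlinarith [mul_le_mul hgg' hbb' hb hg.le]

theorem Rfun_insert_sub_of_notMem {m : ℕ} {p : Fin m → ℝ} (hp : ∀ j, 0 ≤ p j)
    {P S : Finset (Fin m)} {x : Fin m} (hxP : x ∉ P) (hxS : x ∉ S) :
    Rfun m p P (insert x S) - Rfun m p P S =
      p x * ((∑ j ∈ P \ S, p j) / ((∑ j ∈ S \ P, p j) + ∑ j ∈ P \ S, p j) *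
        ((∑ j ∈ P \ S, p j) / ((∑ j ∈ S \ P, p j) + p x + ∑ j ∈ P \ S, p j))) := by
  have h₁ : insert x S ∩ P = S ∩ P := insert_inter_of_notMem hxP
  have h₂ : ∑ j ∈ insert x S \ P, p j = (∑ j ∈ S \ P, p j) + p x := by
    rw [insert_sdiff_of_notMem _ hxP, sum_insert (by simp [hxS]), add_comm]
  have h₃ : P \ insert x S = P \ S := by grind
  rw [← mul_div_add_sub_mul_div_add (sum_nonneg fun j _ => hp j) (sum_nonneg fun j _ => hp j)
    (hp x), Rfun, Rfun, h₁, h₂, h₃]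
  ring

theorem Rfun_insert_sub_of_mem {m : ℕ} {p : Fin m → ℝ} (hp : ∀ j, 0 ≤ p j)
    {P S : Finset (Fin m)} {x : Fin m} (hxP : x ∈ P) (hxS : x ∉ S) :
    Rfun m p P (insert x S) - Rfun m p P S =
      p x - p x * ((∑ j ∈ S \ P, p j) / ((∑ j ∈ P \ insert x S, p j) + ∑ j ∈ S \ P, p j) *
        ((∑ j ∈ S \ P, p j) / ((∑ j ∈ P \ insert x S, p j) + p x + ∑ j ∈ S \ P, p j))) := by
  have h₁ : ∑ j ∈ insert x S ∩ P, p j = p x + ∑ j ∈ S ∩ P, p j := by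
    rw [insert_inter_of_mem hxP, sum_insert (by simp [hxS])]
  have h₂ : insert x S \ P = S \ P := insert_sdiff_of_mem _ hxP
  have h₃ : ∑ j ∈ P \ S, p j = (∑ j ∈ P \ insert x S, p j) + p x := by
    have h : P \ S = insert x (P \ insert x S) := by grind
    rw [h, sum_insert (by simp), add_comm]
  rw [← mul_div_add_sub_mul_div_add (sum_nonneg fun j _ => hp j) (sum_nonneg fun j _ => hp j)
    (hp x), Rfun, Rfun, h₁, h₂, h₃]
  simp only [add_comm (∑ j ∈ S \ P, p j), mul_comm (∑ j ∈ S \ P, p j)]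
  ring

/-- The set function R is submodular (has decreasing marginal utilities). -/
theorem Rfun_submodular (m : ℕ) (hm : 1 ≤ m) (p : Fin m → ℝ) (hp : ∀ j, 0 ≤ p j)
    (P : Finset (Fin m)) (S T : Finset (Fin m)) (hST : S ⊆ T)
    (x : Fin m) (hx : x ∉ T) :
    Rfun m p P (insert x S) - Rfun m p P S ≥
      Rfun m p P (insert x T) - Rfun m p P T := by
  have hsum (U V : Finset (Fin m)) (h : U ⊆ V) : ∑ j ∈ U, p j ≤ ∑ j ∈ V, p j :=
    sum_le_sum_of_subset_of_nonneg h fun j _ _ => hp j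
  have hnonneg (U : Finset (Fin m)) : 0 ≤ ∑ j ∈ U, p j := sum_nonneg fun j _ => hp j
  have hxS : x ∉ S := fun h => hx (hST h)
  have hβ := hsum (S \ P) (T \ P) (sdiff_subset_sdiff hST Subset.rfl)
  have hpx := hp x
  by_cases hxP : x ∈ P
  · rw [Rfun_insert_sub_of_mem hp hxP hxS, Rfun_insert_sub_of_mem hp hxP hx]
    have hγ := hsum (P \ insert x T) (P \ insert x S)
      (sdiff_subset_sdiff Subset.rfl (insert_subset_insert x hST))
    have hγ₀ := hnonneg (P \ insert x T)
    have hγ₁ := hnonneg (P \ insert x S)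
    have hβ₀ := hnonneg (S \ P)
    have hβ₁ := hnonneg (T \ P)
    refine sub_le_sub_left (mul_le_mul_of_nonneg_left (mul_le_mul ?_ ?_ ?_ ?_) hpx) _
    · exact div_add_le_div_add hγ₀ hγ hβ₀ hβ
    · exact div_add_le_div_add (by positivity) (by gcongr) hβ₀ hβ
    · positivity
    · positivity
  · rw [Rfun_insert_sub_of_notMem hp hxP hxS, Rfun_insert_sub_of_notMem hp hxP hx]
    have hγ := hsum (P \ T) (P \ S) (sdiff_subset_sdiff Subset.rfl hST)
    have hγ₀ := hnonneg (P \ T)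
    have hγ₁ := hnonneg (P \ S)
    have hβ₀ := hnonneg (S \ P)
    have hβ₁ := hnonneg (T \ P)
    refine mul_le_mul_of_nonneg_left (mul_le_mul ?_ ?_ ?_ ?_) hpx
    · exact div_add_le_div_add hβ₀ hβ hγ₀ hγ
    · exact div_add_le_div_add (by positivity) (by gcongr) hγ₀ hγ
    · positivity
    · positivity
end

section
/- For every integer k ≥ 1 and every real ρ with 1/(k+1) ≤ ρ ≤ 1/k, it holds that (1 + 1/ρ)(1 + ρk(k+1)) ≥ (1 + √(k(k+1)))², and moreover (1 + √(k(k+1)))² ≥ (97/100)·(k+1)(k+2). Consequently, (1+1/ρ)(1+ρk(k+1)) / ((k+1)(k+2)) ≥ 97/100. -/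
/-- For every integer k ≥ 1 and real ρ with 1/(k+1) ≤ ρ ≤ 1/k,
(1 + 1/ρ)(1 + ρk(k+1)) ≥ (1 + √(k(k+1)))², and (1 + √(k(k+1)))² ≥ (97/100)(k+1)(k+2);
consequently (1+1/ρ)(1+ρk(k+1))/((k+1)(k+2)) ≥ 97/100. -/
theorem small_rho_estimate (k : ℕ) (hk : 1 ≤ k) (ρ : ℝ)
    (h1 : 1 / ((k : ℝ) + 1) ≤ ρ) (h2 : ρ ≤ 1 / (k : ℝ)) :
    (1 + 1 / ρ) * (1 + ρ * k * (k + 1)) ≥ (1 + Real.sqrt ((k : ℝ) * (k + 1))) ^ 2 ∧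
    (1 + Real.sqrt ((k : ℝ) * (k + 1))) ^ 2 ≥ (97 / 100) * ((k : ℝ) + 1) * ((k : ℝ) + 2) ∧
    (1 + 1 / ρ) * (1 + ρ * k * (k + 1)) / (((k : ℝ) + 1) * ((k : ℝ) + 2)) ≥ 97 / 100 := by
  have hk' : (1 : ℝ) ≤ k := by exact_mod_cast hk
  have hρ : 0 < ρ := lt_of_lt_of_le (by positivity) h1
  have hsq : Real.sqrt ((k : ℝ) * (k + 1)) ^ 2 = (k : ℝ) * (k + 1) :=
    Real.sq_sqrt (by positivity)
  have hs : (k : ℝ) + 41 / 100 ≤ Real.sqrt ((k : ℝ) * (k + 1)) :=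
    Real.le_sqrt_of_sq_le (by nlinarith)
  set s := Real.sqrt ((k : ℝ) * (k + 1))
  have amgm : (1 + 1 / ρ) * (1 + ρ * k * (k + 1)) ≥ (1 + s) ^ 2 := by
    have key : (1 + 1 / ρ) * (1 + ρ * k * (k + 1)) - (1 + s) ^ 2 = (ρ * s - 1) ^ 2 / ρ := by
      field_simp
      linear_combination (-ρ - ρ ^ 2) * hsq
    have : 0 ≤ (ρ * s - 1) ^ 2 / ρ := by positivity
    linarith
  have lower : (1 + s) ^ 2 ≥ (97 / 100) * ((k : ℝ) + 1) * ((k : ℝ) + 2) := by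
    nlinarith
  refine ⟨amgm, lower, ?_⟩
  rw [ge_iff_le, le_div_iff₀ (by positivity)]
  linarith
end

section
/- For all integers s ≥ 1, μ ≥ 1 and ν ≥ 1 with ν ≤ (s+1)μ − 1, it holds that ν² / ((ν+μ)(ν+μ−1)) ≤ s/(s+1). -/
/-- For all integers s, μ, ν ≥ 1 with ν ≤ (s+1)μ − 1,
ν² / ((ν+μ)(ν+μ−1)) ≤ s/(s+1). -/
theorem marginal_upper_bound (s μ ν : ℕ) (hs : 1 ≤ s) (hμ : 1 ≤ μ) (hν : 1 ≤ ν)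
    (h : (ν : ℝ) ≤ (s + 1) * μ - 1) :
    (ν : ℝ) ^ 2 / (((ν : ℝ) + μ) * ((ν : ℝ) + μ - 1)) ≤ (s : ℝ) / ((s : ℝ) + 1) := by
  have hs' : (1 : ℝ) ≤ s := by exact_mod_cast hs
  have hμ' : (1 : ℝ) ≤ μ := by exact_mod_cast hμ
  have hν' : (1 : ℝ) ≤ ν := by exact_mod_cast hν
  have hden : (0 : ℝ) < ((ν : ℝ) + μ) * ((ν : ℝ) + μ - 1) :=
    mul_pos (by linarith) (by linarith)
  have hprod : (0 : ℝ) ≤ ((s : ℝ) - 1) * (μ - 1) :=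
    mul_nonneg (by linarith) (by linarith)
  have hlin : (0 : ℝ) ≤ s * (2 * μ - 1) - ν := by linarith
  have hquad : (0 : ℝ) ≤ ν * (s * (2 * μ - 1) - ν) := mul_nonneg (by linarith) hlin
  have hrest : (0 : ℝ) ≤ s * (μ * ((μ : ℝ) - 1)) :=
    mul_nonneg (by linarith) (mul_nonneg (by linarith) (by linarith))
  rw [div_le_div_iff₀ hden (by linarith)]
  linarith
end

section
/- Let r ∈ [0,1] and ρ ≥ 1 be reals and s ≥ 1 an integer. Then for all non-negative reals θ_s, θ_{s+1}, …, θ_{3s} satisfying Σ_{k=s}^{3s} θ_k = 1 − r and Σ_{k=s}^{3s} k·θ_k ≥ ρ(1−r) − r, it holds that r + Σ_{k=s}^{3s} (k/(k+1))·θ_k ≥ (9/10)·(ρ+r)/(ρ+1). -/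
open Finset

/-- The polynomial inequality behind the bound `k / (k + 1) ≥ s / (s + 1)`. -/
lemma polynomial_bound_of_mul_sub_le_one {s : ℕ} (hs : 1 ≤ s) {q x : ℝ} (hq : 0 ≤ q)
    (hq1 : q ≤ 1) (hx : 2 ≤ x) (h : q * (x - s) ≤ 1) :
    0 ≤ x * (s + 1) + 9 * q * (s + 1) - 10 * (q * x) := by
  have hs' : (1 : ℝ) ≤ s := by exact_mod_cast hs
  rcases le_total (10 * q) (s + 1) with hc | hc
  · nlinarith [mul_nonneg (sub_nonneg.2 hc) (by linarith : 0 ≤ x),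
      mul_nonneg hq (by linarith : (0 : ℝ) ≤ s + 1)]
  · have hqpos : 0 < q := by linarith
    have key : 0 ≤ s + 1 - 10 * q + q * s * (s + 1) - q ^ 2 * s + 9 * q ^ 2 := by
      obtain rfl | rfl | h3 : s = 1 ∨ s = 2 ∨ 3 ≤ s := by omega
      · norm_num
        nlinarith [sq_nonneg (2 * q - 1)]
      · norm_num
        nlinarith [sq_nonneg (7 * q - 2)]
      · have h3' : (3 : ℝ) ≤ s := by exact_mod_cast h3
        have h9 : (9 : ℝ) ≤ s ^ 2 := by nlinarith
        nlinarith [mul_nonneg (mul_nonneg hq (sub_nonneg.2 hq1)) (by linarith : (0 : ℝ) ≤ s),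
          mul_nonneg hq (sub_nonneg.2 h9), sq_nonneg q]
    have hmul : 0 ≤ q * (x * (s + 1) + 9 * q * (s + 1) - 10 * (q * x)) := by
      nlinarith [mul_nonneg (sub_nonneg.2 hc) (sub_nonneg.2 h)]
    exact nonneg_of_mul_nonneg_right hmul hqpos

/-- The polynomial inequality behind the chord bound for `k / (k + 1)` on `[s, 3 * s]`. -/
lemma polynomial_bound_of_one_le_mul_sub {s : ℕ} (hs : 1 ≤ s) {q x : ℝ} (hq : 0 ≤ q)
    (hq1 : q ≤ 1) (hx : 2 ≤ x) (h : 1 ≤ q * (x - s)) :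
    0 ≤ x * ((s + 1) * (3 * s + 1)) + 9 * q * ((s + 1) * (3 * s + 1)) -
      10 * x * (q * (4 * s + 1 - x) + 1) := by
  obtain rfl | h2 : s = 1 ∨ 2 ≤ s := by omega
  · norm_num at h ⊢
    nlinarith [mul_nonneg (sub_nonneg.2 h) (by linarith : 0 ≤ x),
      mul_nonneg hq (sq_nonneg (x - 3))]
  · have h2' : (2 : ℝ) ≤ s := by exact_mod_cast h2
    have hquad : (0 : ℝ) ≤
        10 * x ^ 2 + x * (3 * s ^ 2 - 36 * s - 19) + (27 * s ^ 2 + 36 * s + 9) := by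
      obtain rfl | rfl | h4 : s = 2 ∨ s = 3 ∨ 4 ≤ s := by omega
      · norm_num
        nlinarith [sq_nonneg (20 * x - 79)]
      · norm_num
        nlinarith [sq_nonneg (x - 5)]
      · have h4' : (4 : ℝ) ≤ s := by exact_mod_cast h4
        nlinarith [sq_nonneg (20 * x - 127),
          mul_nonneg (by linarith : 0 ≤ x) (sq_nonneg ((s : ℝ) - 6))]
    have hP : (0 : ℝ) ≤ (s + 1) * (3 * s + 1) - 10 := by nlinarith
    have hslack := mul_nonneg (mul_nonneg (by linarith : 0 ≤ x) (sub_nonneg.2 hq1)) hP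
    linear_combination hslack + mul_nonneg hq hquad

/-- On `[s, 3 * s]` the concave function `k / (k + 1)` lies above its chord. -/
lemma chord_le_div_add_one {s k : ℝ} (hs : 0 ≤ s) (hk : s ≤ k) (hk' : k ≤ 3 * s) :
    s / (s + 1) + (k - s) / ((s + 1) * (3 * s + 1)) ≤ k / (k + 1) := by
  have hk0 : 0 ≤ k := hs.trans hk
  have hdiff : k / (k + 1) - (s / (s + 1) + (k - s) / ((s + 1) * (3 * s + 1))) =
      (k - s) * (3 * s - k) / ((k + 1) * ((s + 1) * (3 * s + 1))) := by
    field_simp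
    ring
  have := div_nonneg (mul_nonneg (sub_nonneg.2 hk) (sub_nonneg.2 hk'))
    (by positivity : 0 ≤ (k + 1) * ((s + 1) * (3 * s + 1)))
  linarith

/-- The LP form of the main lemma: for r ∈ [0,1], ρ ≥ 1, integer s ≥ 1
and non-negative θ_s,…,θ_{3s} with Σθ_k = 1−r and Σ k·θ_k ≥ ρ(1−r)−r, one has
r + Σ (k/(k+1))·θ_k ≥ (9/10)·(ρ+r)/(ρ+1). -/
theorem lp_lower_bound (r ρ : ℝ) (hr0 : 0 ≤ r) (hr1 : r ≤ 1) (hρ : 1 ≤ ρ)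
    (s : ℕ) (hs : 1 ≤ s) (θ : ℕ → ℝ)
    (hθ : ∀ k ∈ Finset.Icc s (3 * s), 0 ≤ θ k)
    (hsum : ∑ k ∈ Finset.Icc s (3 * s), θ k = 1 - r)
    (hcons : ∑ k ∈ Finset.Icc s (3 * s), (k : ℝ) * θ k ≥ ρ * (1 - r) - r) :
    r + ∑ k ∈ Finset.Icc s (3 * s), ((k : ℝ) / ((k : ℝ) + 1)) * θ k ≥
      (9 / 10) * ((ρ + r) / (ρ + 1)) := by
  set M := ∑ k ∈ Finset.Icc s (3 * s), (k : ℝ) * θ k with hM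
  have hP : (0 : ℝ) < (s + 1) * (3 * s + 1) := by positivity
  have hchord : (s : ℝ) / (s + 1) * (1 - r) + (M - s * (1 - r)) / ((s + 1) * (3 * s + 1)) ≤
      ∑ k ∈ Finset.Icc s (3 * s), ((k : ℝ) / ((k : ℝ) + 1)) * θ k := by
    calc _ = ∑ k ∈ Finset.Icc s (3 * s),
          ((s : ℝ) / (s + 1) + (k - s) / ((s + 1) * (3 * s + 1))) * θ k := by
          simp only [hM, ← hsum, Finset.mul_sum, ← Finset.sum_sub_distrib, Finset.sum_div,
            ← Finset.sum_add_distrib]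
          refine Finset.sum_congr rfl fun k _ => ?_
          ring
      _ ≤ _ := by
          refine Finset.sum_le_sum fun k hk => mul_le_mul_of_nonneg_right ?_ (hθ k hk)
          obtain ⟨h1, h2⟩ := Finset.mem_Icc.1 hk
          exact chord_le_div_add_one (by positivity) (by exact_mod_cast h1)
            (by exact_mod_cast h2)
  have hMs : s * (1 - r) ≤ M := by
    rw [hM, ← hsum, Finset.mul_sum]
    refine Finset.sum_le_sum fun k hk => mul_le_mul_of_nonneg_right ?_ (hθ k hk)
    exact_mod_cast (Finset.mem_Icc.1 hk).1
  have hρ1 : 0 < ρ + 1 := by linarith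
  rcases le_total ((1 - r) * (ρ + 1 - s)) 1 with h | h
  · have hpoly := polynomial_bound_of_mul_sub_le_one hs (sub_nonneg.2 hr1) (by linarith)
      (by linarith) h
    have hextra := div_nonneg (sub_nonneg.2 hMs) hP.le
    have hmain : r + (s : ℝ) / (s + 1) * (1 - r) - (9 / 10) * ((ρ + r) / (ρ + 1)) =
        ((ρ + 1) * (s + 1) + 9 * (1 - r) * (s + 1) - 10 * ((1 - r) * (ρ + 1))) /
          (10 * ((ρ + 1) * (s + 1))) := by
      field_simp
      ring
    have := div_nonneg hpoly (by positivity : 0 ≤ 10 * ((ρ + 1) * ((s : ℝ) + 1)))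
    linarith
  · have hpoly := polynomial_bound_of_one_le_mul_sub hs (sub_nonneg.2 hr1) (by linarith)
      (by linarith) h
    have hextra : (ρ * (1 - r) - r - s * (1 - r)) / ((s + 1) * (3 * s + 1)) ≤
        (M - s * (1 - r)) / ((s + 1) * (3 * s + 1)) := by
      gcongr
    have hmain : r + (s : ℝ) / (s + 1) * (1 - r) +
          (ρ * (1 - r) - r - s * (1 - r)) / ((s + 1) * (3 * s + 1)) -
          (9 / 10) * ((ρ + r) / (ρ + 1)) =
        ((ρ + 1) * ((s + 1) * (3 * s + 1)) + 9 * (1 - r) * ((s + 1) * (3 * s + 1)) -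
          10 * (ρ + 1) * ((1 - r) * (4 * s + 1 - (ρ + 1)) + 1)) /
          (10 * ((ρ + 1) * ((s + 1) * (3 * s + 1)))) := by
      field_simp
      ring
    have := div_nonneg hpoly
      (by positivity : 0 ≤ 10 * ((ρ + 1) * (((s : ℝ) + 1) * (3 * s + 1))))
    linarith
end

section
/- Let ρ ≥ 1 be a real, s ≥ 1 an integer, and r a real with (ρ−1)/ρ ≤ r ≤ 1. Then r + (s/(s+1))·(1−r) ≥ (9/10)·(ρ+r)/(ρ+1). -/
/-- Case I of the LP-duality analysis: for ρ ≥ 1, integer s ≥ 1 and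
(ρ−1)/ρ ≤ r ≤ 1, one has r + (s/(s+1))(1−r) ≥ (9/10)(ρ+r)/(ρ+1). -/
theorem dual_case_one (ρ : ℝ) (hρ : 1 ≤ ρ) (s : ℕ) (hs : 1 ≤ s) (r : ℝ)
    (hr1 : (ρ - 1) / ρ ≤ r) (hr2 : r ≤ 1) :
    r + ((s : ℝ) / ((s : ℝ) + 1)) * (1 - r) ≥ (9 / 10) * ((ρ + r) / (ρ + 1)) := by
  have hρ0 : 0 < ρ := by linarith
  have hs' : (1 : ℝ) ≤ s := by exact_mod_cast hs
  have half_le : (1 : ℝ) / 2 ≤ (s : ℝ) / ((s : ℝ) + 1) := by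
    rw [div_le_div_iff₀ (by norm_num) (by linarith)]
    linarith
  have hr : ρ - 1 ≤ r * ρ := (div_le_iff₀ hρ0).mp hr1
  have key : 0 ≤ 5 - 4 * ρ + r * (5 * ρ - 4) := by
    refine nonneg_of_mul_nonneg_right ?_ hρ0
    nlinarith [mul_le_mul_of_nonneg_right hr (by linarith : 0 ≤ 5 * ρ - 4), sq_nonneg (ρ - 2)]
  calc (9 / 10) * ((ρ + r) / (ρ + 1)) ≤ r + 1 / 2 * (1 - r) := by
        rw [← mul_div_assoc, div_le_iff₀ (by linarith)]
        linarith
    _ ≤ r + ((s : ℝ) / ((s : ℝ) + 1)) * (1 - r) := by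
        have := mul_le_mul_of_nonneg_right half_le (sub_nonneg.mpr hr2)
        linarith
end

section
/- Let ρ ≥ 1 be a real, s ≥ 1 an integer, and r a real with 0 ≤ r ≤ (ρ−1)/ρ. Then r + (3s²·(1−r))/((s+1)(3s+1)) + (ρ(1−r) − r)/((s+1)(3s+1)) ≥ (9/10)·(ρ+r)/(ρ+1). -/
/-- Case II of the LP-duality analysis: for ρ ≥ 1, integer s ≥ 1 and
0 ≤ r ≤ (ρ−1)/ρ, one has
r + 3s²(1−r)/((s+1)(3s+1)) + (ρ(1−r)−r)/((s+1)(3s+1)) ≥ (9/10)(ρ+r)/(ρ+1). -/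
theorem dual_case_two (ρ : ℝ) (hρ : 1 ≤ ρ) (s : ℕ) (hs : 1 ≤ s) (r : ℝ)
    (hr0 : 0 ≤ r) (hr1 : r ≤ (ρ - 1) / ρ) :
    r + (3 * (s : ℝ) ^ 2 * (1 - r)) / (((s : ℝ) + 1) * (3 * (s : ℝ) + 1)) +
        (ρ * (1 - r) - r) / (((s : ℝ) + 1) * (3 * (s : ℝ) + 1)) ≥
      (9 / 10) * ((ρ + r) / (ρ + 1)) := by
  have hs' : (1 : ℝ) ≤ s := by exact_mod_cast hs
  generalize (s : ℝ) = x at hs' ⊢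
  have hρ0 : 0 < ρ := by linarith
  have hD : 0 < (x + 1) * (3 * x + 1) := by positivity
  have hr : r * ρ ≤ ρ - 1 := (le_div_iff₀ hρ0).mp hr1
  -- The cleared inequality is affine in `r`, so it suffices to check both endpoints.
  have left_endpoint : 0 ≤ 10 * ρ ^ 2 + ρ * (3 * x ^ 2 - 36 * x + 1) + 30 * x ^ 2 := by
    have hsq : 0 ≤ 10 * (ρ - 17 / 10 * x) ^ 2 + 11 / 10 * x ^ 2 := by positivity
    have hquad : 0 ≤ ρ * (3 * x ^ 2 - 2 * x + 1) :=
      mul_nonneg hρ0.le (by nlinarith [sq_nonneg (x - 1)])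
    nlinarith
  have right_endpoint : 0 ≤ (x + 1) * (3 * x + 1) * (ρ ^ 2 - 9 * ρ - 1) +
      10 * (ρ + 1) * (3 * x ^ 2 + 1) := by
    have hsq : 0 ≤ (x + 1) * (3 * x + 1) * (ρ - 2) ^ 2 := by positivity
    have hquad : 0 ≤ 5 * (ρ + 1) * ((3 * x - 1) * (x - 1)) :=
      mul_nonneg (by positivity) (mul_nonneg (by linarith) (by linarith))
    linarith
  have cleared : 0 ≤ 10 * (ρ + 1) * (r * ((x + 1) * (3 * x + 1)) + 3 * x ^ 2 * (1 - r) +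
      (ρ * (1 - r) - r)) - 9 * (ρ + r) * ((x + 1) * (3 * x + 1)) := by
    rcases hρ.eq_or_lt with rfl | hρ1
    · obtain rfl : r = 0 := by linarith
      linarith
    · refine nonneg_of_mul_nonneg_right (a := ρ - 1) ?_ (by linarith)
      have hl := mul_nonneg (sub_nonneg.mpr hr) left_endpoint
      have hR := mul_nonneg hr0 right_endpoint
      linarith
  rw [ge_iff_le, ← sub_nonneg]
  have key : r + 3 * x ^ 2 * (1 - r) / ((x + 1) * (3 * x + 1)) +
      (ρ * (1 - r) - r) / ((x + 1) * (3 * x + 1)) - 9 / 10 * ((ρ + r) / (ρ + 1)) =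
      (10 * (ρ + 1) * (r * ((x + 1) * (3 * x + 1)) + 3 * x ^ 2 * (1 - r) +
      (ρ * (1 - r) - r)) - 9 * (ρ + r) * ((x + 1) * (3 * x + 1))) /
      (10 * (ρ + 1) * ((x + 1) * (3 * x + 1))) := by
    field_simp
  rw [key]
  exact div_nonneg cleared (by positivity)
end

section
/- Let t ≥ 1, let w_1,…,w_t be positive integers with W = Σ_{j=1}^t w_j, and consider the single-row function R on subsets of [t+1] defined with P = [t], Z = {t+1}, probabilities p_j = w_j/(2W) for j ≤ t and p_{t+1} = 1/2, i.e., R(S) = Σ_{j∈S∩[t]} p_j + β(S)γ(S)/(β(S)+γ(S)) where β(S) = p_{t+1} if t+1 ∈ S and 0 otherwise, γ(S) = Σ_{j∈[t]\S} p_j, and the fraction is 0 when β(S)+γ(S) = 0. Set prices q_j = 5w_j/(18W) for j ≤ t and q_{t+1} = 0. Then there exists S ⊆ [t+1] with R(S) − Σ_{j∈S} q_j ≥ 5/18 if and only if there exists Y ⊆ [t] with 2·Σ_{j∈Y} w_j = W. -/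
open Finset

/-- A sum over a finset of `Fin (t + 1)`, with the last index split off. -/
theorem sum_eq_sum_castSucc_add_last {t : ℕ} (f : Fin (t + 1) → ℝ) (S : Finset (Fin (t + 1))) :
    ∑ j ∈ S, f j = ∑ j with Fin.castSucc j ∈ S, f (Fin.castSucc j) +
      if Fin.last t ∈ S then f (Fin.last t) else 0 := by
  have h : ∑ j ∈ S, f j = ∑ j, if j ∈ S then f j else 0 := by simp
  rw [h, Fin.sum_univ_castSucc, Finset.sum_filter]

/-- The utility of a set `S` in the reduction, as a function of the fraction `x` of the total
weight that `S` carries. -/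
theorem Rfun_sub_price {t : ℕ} (w : Fin t → ℕ) (W : ℕ) (hW : W = ∑ j, w j) (hpos : 0 < W)
    (p q : Fin (t + 1) → ℝ)
    (hp : ∀ j : Fin t, p j.castSucc = (w j : ℝ) / (2 * W)) (hplast : p (Fin.last t) = 1 / 2)
    (hq : ∀ j : Fin t, q j.castSucc = 5 * (w j : ℝ) / (18 * W)) (hqlast : q (Fin.last t) = 0)
    (S : Finset (Fin (t + 1))) (x : ℝ)
    (hx : ∑ j with Fin.castSucc j ∈ S, (w j : ℝ) = x * W) :
    Rfun (t + 1) p (univ.filter fun j : Fin (t + 1) => (j : ℕ) < t) S - ∑ j ∈ S, q j =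
      2 * x / 9 +
        if Fin.last t ∈ S then 1 / 2 * ((1 - x) / 2) / (1 / 2 + (1 - x) / 2) else 0 := by
  have hW0 : (W : ℝ) ≠ 0 := by positivity
  have hx' : ∑ j with Fin.castSucc j ∉ S, (w j : ℝ) = (1 - x) * W := by
    have h := Finset.sum_filter_add_sum_filter_not univ (fun j => Fin.castSucc j ∈ S)
      (fun j => (w j : ℝ))
    have hW' : (W : ℝ) = ∑ j, (w j : ℝ) := by exact_mod_cast hW
    rw [hx, ← hW'] at h
    linarith
  have hα : ∑ j ∈ S ∩ univ.filter (fun j : Fin (t + 1) => (j : ℕ) < t), p j = x / 2 := by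
    rw [sum_eq_sum_castSucc_add_last]
    simp only [mem_inter, mem_filter, mem_univ, Fin.val_castSucc, Fin.is_lt, and_true,
      Fin.val_last, lt_irrefl, and_false, if_false, add_zero, hp, ← Finset.sum_div, hx]
    field_simp
  have hβ : ∑ j ∈ S \ univ.filter (fun j : Fin (t + 1) => (j : ℕ) < t), p j =
      if Fin.last t ∈ S then 1 / 2 else 0 := by
    rw [sum_eq_sum_castSucc_add_last]
    simp [hplast]
  have hγ : ∑ j ∈ univ.filter (fun j : Fin (t + 1) => (j : ℕ) < t) \ S, p j = (1 - x) / 2 := by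
    rw [sum_eq_sum_castSucc_add_last]
    simp only [mem_sdiff, mem_filter, mem_univ, true_and, Fin.val_castSucc, Fin.is_lt,
      Fin.val_last, lt_irrefl, false_and, if_false, add_zero, hp, ← Finset.sum_div, hx']
    field_simp
  have hprice : ∑ j ∈ S, q j = 5 * x / 18 := by
    rw [sum_eq_sum_castSucc_add_last]
    simp only [hq, hqlast, ite_self, add_zero, ← Finset.sum_div, ← Finset.mul_sum, hx]
    field_simp
  rw [Rfun, hα, hβ, hγ, hprice]
  split_ifs
  · ring
  · simp only [zero_mul, zero_div]
    ring

/-- Correctness of the reduction from Partition to demand queries: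
with the single-row instance given by positive integer weights w_1,…,w_t of total
weight W, probabilities p_j = w_j/(2W) for j ≤ t and 1/2 for the zero-column, and
prices q_j = 5w_j/(18W) for j ≤ t and 0 for the zero-column, there is a set S with
R(S) − Σ_{j∈S} q_j ≥ 5/18 iff there is a set Y of weights summing to W/2. -/
theorem demand_query_partition_reduction (t : ℕ) (ht : 1 ≤ t)
    (w : Fin t → ℕ) (hw : ∀ j, 0 < w j) (W : ℕ) (hW : W = ∑ j, w j)
    (p q : Fin (t + 1) → ℝ)
    (hp : ∀ (j : Fin (t + 1)) (h : (j : ℕ) < t), p j = (w ⟨j, h⟩ : ℝ) / (2 * W))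
    (hplast : p (Fin.last t) = 1 / 2)
    (hq : ∀ (j : Fin (t + 1)) (h : (j : ℕ) < t), q j = 5 * (w ⟨j, h⟩ : ℝ) / (18 * W))
    (hqlast : q (Fin.last t) = 0)
    (P : Finset (Fin (t + 1)))
    (hP : P = Finset.univ.filter (fun j : Fin (t + 1) => (j : ℕ) < t)) :
    (∃ S : Finset (Fin (t + 1)), Rfun (t + 1) p P S - ∑ j ∈ S, q j ≥ 5 / 18) ↔
      (∃ Y : Finset (Fin t), 2 * ∑ j ∈ Y, w j = W) := by
  have hpos : 0 < W := by
    rw [hW]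
    exact Finset.sum_pos (fun j _ => hw j) ⟨⟨0, ht⟩, mem_univ _⟩
  have hWpos : (0 : ℝ) < W := by exact_mod_cast hpos
  have key := Rfun_sub_price w W hW hpos p q (fun j => hp j.castSucc j.is_lt) hplast
    (fun j => hq j.castSucc j.is_lt) hqlast
  subst hP
  constructor
  · rintro ⟨S, hS⟩
    refine ⟨univ.filter fun j => Fin.castSucc j ∈ S, ?_⟩
    obtain ⟨x, hx⟩ : ∃ x : ℝ, ∑ j with Fin.castSucc j ∈ S, (w j : ℝ) = x * W :=
      ⟨_, (div_mul_cancel₀ _ hWpos.ne').symm⟩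
    have hx1 : x ≤ 1 := by
      have h : ∑ j with Fin.castSucc j ∈ S, (w j : ℝ) ≤ W := by
        rw [hW]
        exact_mod_cast Finset.sum_le_sum_of_subset (filter_subset _ _)
      rw [hx] at h
      nlinarith
    rw [key S x hx] at hS
    split_ifs at hS with hl
    · have hd : (0 : ℝ) < 1 / 2 + (1 - x) / 2 := by linarith
      have h1 : 5 / 18 - 2 * x / 9 ≤ 1 / 2 * ((1 - x) / 2) / (1 / 2 + (1 - x) / 2) := by
        linarith
      rw [le_div_iff₀ hd] at h1
      have h2 : (2 * x - 1) ^ 2 = 0 := le_antisymm (by nlinarith) (sq_nonneg _)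
      have h3 : 2 * x = 1 := by linarith [pow_eq_zero_iff two_ne_zero |>.mp h2]
      have h4 : 2 * ∑ j with Fin.castSucc j ∈ S, (w j : ℝ) = W := by
        rw [hx, ← mul_assoc, h3, one_mul]
      exact_mod_cast h4
    · linarith
  · rintro ⟨Y, hY⟩
    refine ⟨insert (Fin.last t) (Y.map Fin.castSuccEmb), ?_⟩
    rw [key _ (1 / 2)]
    · norm_num
    · have h : (2 : ℝ) * ∑ j ∈ Y, (w j : ℝ) = W := by exact_mod_cast hY
      have hfilter : (univ.filter fun j : Fin t =>
          j.castSucc ∈ insert (Fin.last t) (Y.map Fin.castSuccEmb)) = Y := by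
        ext j
        simp [Fin.castSucc_ne_last]
      rw [hfilter]
      linarith
end
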